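/- arXiv:math/0406326 — 2 statements merged into one kernel-verified Lean document; each statement's English description precedes it below -/
import Mathlib

section
/- Let T : Δ → Δ be a measurable map on a simplex Δ compactly contained in the standard open simplex, with a countable partition {Δ^(l)} into positive-measure sets, such that T maps each Δ^(l) bijectively onto Δ and (T|Δ^(l))⁻¹ is the restriction of a projective contraction. Then T preserves a probability measure μ absolutely continuous with respect to Lebesgue measure, whose density is continuous and positive on the closure of Δ. -/
open MeasureTheory
open scoped BigOperators ENNReal

/-- The open standard simplex in `ℝ^p`. -/
def openStdSimplex (p : ℕ) : Set (Fin p → ℝ) := {x | (∀ i, 0 < x i) ∧ ∑ i, x i = 1}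

/-- The projectivization (in the simplex chart) of the linear map given by the matrix `B`. -/
noncomputable def projNormalize {p : ℕ} (B : Matrix (Fin p) (Fin p) ℝ) :
    (Fin p → ℝ) → (Fin p → ℝ) :=
  fun x => (∑ i, B.mulVec x i)⁻¹ • B.mulVec x

/-- Affine chart of the hyperplane `∑ x = 1`. -/
def chartE {n : ℕ} (u : Fin n → ℝ) : Fin (n+1) → ℝ := Fin.cons (1 - ∑ i, u i) u

/-- Projection onto the last coordinates. -/
def chartP {n : ℕ} (x : Fin (n+1) → ℝ) : Fin n → ℝ := fun i => x i.succ

/-- Jacobian of the projective map. -/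
noncomputable def projJac {p : ℕ} (B : Matrix (Fin p) (Fin p) ℝ) (y : Fin p → ℝ) : ℝ :=
  |B.det| / (∑ i, B.mulVec y i) ^ p

/-- linear part of the chart -/
def chartC (n : ℕ) : Matrix (Fin (n+1)) (Fin n) ℝ :=
  Matrix.of fun k j => Fin.cases (-1) (fun i => if i = j then 1 else 0) k

lemma chartC_zero {n : ℕ} (j : Fin n) : chartC n 0 j = -1 := rfl

lemma chartC_succ {n : ℕ} (i j : Fin n) : chartC n i.succ j = if i = j then 1 else 0 := rfl

lemma chartC_mulVec {n : ℕ} (v : Fin n → ℝ) :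
    (chartC n).mulVec v = Fin.cons (- ∑ i, v i) v := by
  ext k
  refine Fin.cases ?_ (fun i => ?_) k
  · simp [chartC_zero, chartC_succ, Matrix.mulVec, dotProduct]
  · simp [chartC_zero, chartC_succ, Matrix.mulVec, dotProduct]

lemma chartE_eq {n : ℕ} (u : Fin n → ℝ) :
    chartE u = Pi.single 0 1 + (chartC n).mulVec u := by
  rw [chartC_mulVec]
  ext k
  refine Fin.cases ?_ (fun i => ?_) k
  · simp [chartE]; ring
  · simp [chartE]

lemma chartP_chartE {n : ℕ} (u : Fin n → ℝ) : chartP (chartE u) = u := by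
  ext i; simp [chartP, chartE]

lemma chartE_sum {n : ℕ} (u : Fin n → ℝ) : ∑ i, chartE u i = 1 := by
  simp [chartE, Fin.sum_univ_succ]

lemma chartE_chartP {n : ℕ} (x : Fin (n+1) → ℝ) (hx : ∑ i, x i = 1) : chartE (chartP x) = x := by
  ext k
  refine Fin.cases ?_ (fun i => ?_) k
  · simp [chartE, chartP]
    rw [Fin.sum_univ_succ] at hx; linarith
  · simp [chartE, chartP]

lemma continuous_chartP {n : ℕ} : Continuous (chartP (n := n)) := by
  unfold chartP; fun_prop

lemma continuous_chartE {n : ℕ} : Continuous (chartE (n := n)) := by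
  have : (chartE (n := n)) = fun u => Pi.single 0 1 + (chartC n).mulVec u := by
    ext1 u; exact chartE_eq u
  rw [this]; fun_prop

lemma chartE_range {n : ℕ} : Set.range (chartE (n := n)) = {x | ∑ i, x i = 1} := by
  ext x; constructor
  · rintro ⟨u, rfl⟩; exact chartE_sum u
  · intro hx; exact ⟨_, chartE_chartP x hx⟩

lemma chartE_embedding {n : ℕ} : MeasurableEmbedding (chartE (n := n)) := by
  apply Topology.IsClosedEmbedding.measurableEmbedding
  refine ⟨Topology.IsEmbedding.of_leftInverse chartP_chartE continuous_chartP continuous_chartE, ?_⟩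
  rw [chartE_range]
  exact isClosed_eq (by fun_prop) continuous_const

lemma chartE_lip {n : ℕ} : ∃ K, LipschitzWith K (chartE (n := n)) := by
  let f : (Fin n → ℝ) →L[ℝ] (Fin (n+1) → ℝ) := (Matrix.toLin' (chartC n)).toContinuousLinearMap
  refine ⟨‖f‖₊, ?_⟩
  have : (chartE (n := n)) = fun u => Pi.single 0 1 + f u := by
    ext1 u; rw [chartE_eq u]; simp [f]
  rw [this]
  have h := f.lipschitz
  intro x y
  simpa using h x y

lemma chart_measure (n : ℕ) : ∃ c : NNReal, (μH[(n:ℝ)] : Measure (Fin (n+1) → ℝ)).restrict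
    {x | ∑ i, x i = 1} = c • (volume : Measure (Fin n → ℝ)).map chartE := by
  set ν : Measure (Fin n → ℝ) := (μH[(n:ℝ)] : Measure (Fin (n+1) → ℝ)).comap chartE with hν
  have hνa : ∀ s, ν s = μH[(n:ℝ)] (chartE '' s) := fun s =>
    chartE_embedding.comap_apply _ _
  obtain ⟨K, hK⟩ := chartE_lip (n := n)
  have : IsFiniteMeasureOnCompacts ν := by
    refine ⟨fun S hS => ?_⟩
    rw [hνa]
    refine lt_of_le_of_lt (hK.hausdorffMeasure_image_le (by positivity) S) ?_
    have h1 : (μH[(n:ℝ)] : Measure (Fin n → ℝ)) = volume := by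
      have := hausdorffMeasure_pi_real (ι := Fin n)
      simpa using this
    rw [h1]
    refine ENNReal.mul_lt_top ?_ hS.measure_lt_top
    exact ENNReal.rpow_lt_top_of_nonneg (by positivity) (by simp)
  have : ν.IsAddLeftInvariant := by
    refine ⟨fun g => ?_⟩
    ext s hs
    rw [Measure.map_apply (measurable_const_add g) hs, hνa, hνa]
    have : chartE '' s = (IsometryEquiv.addLeft ((chartC n).mulVec g)) '' (chartE '' ((fun x => g + x) ⁻¹' s)) := by
      rw [Set.image_image]
      have : ∀ u, (IsometryEquiv.addLeft ((chartC n).mulVec g)) (chartE u) = chartE (g + u) := by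
        intro u
        simp [chartE_eq, Matrix.mulVec_add]; abel
      simp only [this]
      ext x; constructor
      · rintro ⟨u, hu, rfl⟩; exact ⟨-g + u, by simpa using hu, by simp⟩
      · rintro ⟨u, hu, rfl⟩; exact ⟨g+u, hu, rfl⟩
    rw [this, IsometryEquiv.hausdorffMeasure_image]
  refine ⟨ν.addHaarScalarFactor volume, ?_⟩
  rw [← Measure.map_smul, ← Measure.isAddLeftInvariant_eq_smul ν volume, hν,
    chartE_embedding.map_comap, chartE_range]

lemma chart_det {n : ℕ} (B : Matrix (Fin (n+1)) (Fin (n+1)) ℝ) (u : Fin n → ℝ)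
    (hq : ∑ i, B.mulVec (chartE u) i ≠ 0) :
    (Matrix.of fun i j : Fin n => (B * chartC n) i.succ j -
      (∑ k, B.mulVec (chartE u) k)⁻¹ * (∑ k, (B * chartC n) k j) * B.mulVec (chartE u) i.succ).det
      * (∑ i, B.mulVec (chartE u) i) = B.det := by
  set q := ∑ i, B.mulVec (chartE u) i with hqdef
  obtain ⟨R1, hR1⟩ : ∃ R1 : Matrix (Fin n) (Fin (n+1)) ℝ,
    ∀ i k, R1 i k = (if k = i.succ then 1 else 0) - u i := ⟨Matrix.of fun i k => _, fun _ _ => rfl⟩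
  obtain ⟨R2, hR2⟩ : ∃ R2 : Matrix Unit (Fin (n+1)) ℝ,
    ∀ i k, R2 i k = 1 := ⟨Matrix.of fun i k => _, fun _ _ => rfl⟩
  obtain ⟨C2, hC2⟩ : ∃ C2 : Matrix (Fin (n+1)) Unit ℝ,
    ∀ k i, C2 k i = chartE u k := ⟨Matrix.of fun i k => _, fun _ _ => rfl⟩
  have hL : Matrix.fromCols (chartC n) C2 * Matrix.fromRows R1 R2 = 1 := by
    rw [Matrix.fromCols_mul_fromRows]
    ext k l
    refine Fin.cases ?_ (fun i => ?_) k
    · refine Fin.cases ?_ (fun j => ?_) l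
      · simp [Matrix.mul_apply, chartC_zero, chartC_succ, hR1, hR2, hC2, chartE, Fin.sum_univ_succ, (Fin.succ_ne_zero _).symm]
      · simp [Matrix.mul_apply, chartC_zero, chartC_succ, hR1, hR2, hC2, chartE, Fin.sum_univ_succ, (Fin.succ_ne_zero _).symm]
    · refine Fin.cases ?_ (fun j => ?_) l
      · simp [Matrix.mul_apply, chartC_zero, chartC_succ, hR1, hR2, hC2, chartE, (Fin.succ_ne_zero _).symm]
      · simp [Matrix.mul_apply, chartC_zero, chartC_succ, hR1, hR2, hC2, chartE, Matrix.one_apply, eq_comm]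
  have hcard : Fintype.card (Fin n ⊕ Unit) = Fintype.card (Fin (n+1)) := by simp
  have hR : Matrix.fromRows R1 R2 * Matrix.fromCols (chartC n) C2 = 1 := by
    rw [Matrix.fromRows_mul_fromCols, ← Matrix.fromBlocks_one]
    congr 1
    · ext i j
      simp [Matrix.mul_apply, chartC_zero, chartC_succ, hR1, sub_mul, Finset.sum_sub_distrib, Fin.sum_univ_succ, Matrix.one_apply, Finset.mul_sum, (Fin.succ_ne_zero _).symm]
    · ext i j
      simp [Matrix.mul_apply, hR1, hC2, sub_mul, Finset.sum_sub_distrib, ← Finset.mul_sum, chartE_sum]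
      simp [chartE]
    · ext i j
      simp [Matrix.mul_apply, chartC_zero, chartC_succ, hR2, Fin.sum_univ_succ]
    · ext i j
      simp [Matrix.mul_apply, hR2, hC2, chartE_sum]
  have hdet := Matrix.det_conj_of_mul_eq_one (N := B) hR hL
  rw [← hdet, Matrix.mul_assoc, Matrix.mul_fromCols, Matrix.fromRows_mul_fromCols]
  have hBC : ∀ k, (B * C2) k () = B.mulVec (chartE u) k := by
    intro k; simp [Matrix.mul_apply, hC2, Matrix.mulVec, dotProduct]
  have hD : R2 * (B * C2) = Matrix.of fun _ _ => q := by
    ext i j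
    simp only [Matrix.mul_apply (M := R2), hR2, one_mul]
    simp [hBC, hqdef]
  rw [hD]
  let D' : Matrix Unit Unit ℝ := Matrix.of fun _ _ => q⁻¹
  let : Invertible (Matrix.of fun (_ _ : Unit) => q) := by
    refine ⟨D', ?_, ?_⟩ <;> ext i j <;> simp [D', Matrix.mul_apply, hq]
  rw [Matrix.det_fromBlocks₂₂]
  have hinv : ⅟ (Matrix.of fun (_ _ : Unit) => q) = D' := rfl
  rw [hinv, mul_comm]
  congr 1
  · simp
  · congr 1
    ext i j
    have e1 : ∀ (m : Type) (M : Matrix (Fin (n+1)) m ℝ) (j : m), (R1 * M) i j = M i.succ j - u i * ∑ k, M k j := by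
      intro m M j
      simp [Matrix.mul_apply, hR1, sub_mul, Finset.sum_sub_distrib, Finset.mul_sum]
    have e2 : ∀ (j : Fin n), (R2 * (B * chartC n)) () j = ∑ k, (B * chartC n) k j := by
      intro j; simp [Matrix.mul_apply (M := R2), hR2]
    rw [Matrix.sub_apply, Matrix.mul_apply (M := R1 * (B * C2) * D')]
    simp only [Finset.univ_unique, Finset.sum_singleton, Matrix.of_apply]
    rw [Matrix.mul_apply (M := R1 * (B * C2))]
    simp only [Finset.univ_unique, Finset.sum_singleton, PUnit.default_eq_unit, e1, e2, hBC, D', Matrix.of_apply]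
    try rw [← hqdef]
    field_simp
    ring

lemma chart_hasFDerivAt {n : ℕ} (B : Matrix (Fin (n+1)) (Fin (n+1)) ℝ) (u : Fin n → ℝ)
    (hq : ∑ i, B.mulVec (chartE u) i ≠ 0) :
    ∃ f' : (Fin n → ℝ) →L[ℝ] (Fin n → ℝ),
      HasFDerivAt (fun u => chartP (projNormalize B (chartE u))) f' u ∧
      f'.det = B.det / (∑ i, B.mulVec (chartE u) i) ^ (n+1) := by
  set q := ∑ i, B.mulVec (chartE u) i with hqdef
  set M : Matrix (Fin n) (Fin n) ℝ := Matrix.of fun i j : Fin n => (B * chartC n) i.succ j -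
      q⁻¹ * (∑ k, (B * chartC n) k j) * B.mulVec (chartE u) i.succ with hM
  have hMdet : M.det * q = B.det := chart_det B u hq
  refine ⟨(Matrix.toLin' (q⁻¹ • M)).toContinuousLinearMap, ?_, ?_⟩
  · let N' : (Fin n → ℝ) →L[ℝ] (Fin (n+1) → ℝ) := (Matrix.toLin' (B * chartC n)).toContinuousLinearMap
    have hN : ∀ v, B.mulVec (chartE v) = B.mulVec (Pi.single 0 1) + N' v := by
      intro v; simp [N', chartE_eq, Matrix.mulVec_add]
    have hNd : HasFDerivAt (fun v => B.mulVec (chartE v)) N' u := by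
      simp only [hN]
      exact N'.hasFDerivAt.const_add _
    have hNi : ∀ k, HasFDerivAt (fun v => B.mulVec (chartE v) k)
        ((ContinuousLinearMap.proj k).comp N') u := fun k => (hasFDerivAt_pi'.1 hNd) k
    have hqd : HasFDerivAt (fun v => ∑ k, B.mulVec (chartE v) k)
        (∑ k, (ContinuousLinearMap.proj k).comp N') u :=
      HasFDerivAt.fun_sum fun k _ => hNi k
    rw [hasFDerivAt_pi']
    intro i
    have h1 := ((hasDerivAt_inv hq).comp_hasFDerivAt u hqd).mul (hNi i.succ)
    refine h1.congr_fderiv ?_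
    ext v
    have hw : ∀ k, N' v k = ∑ j, (B * chartC n) k j * v j := by
      intro k; rfl
    simp only [ContinuousLinearMap.comp_apply, ContinuousLinearMap.proj_apply,
      LinearMap.coe_toContinuousLinearMap', Matrix.toLin'_apply, ContinuousLinearMap.add_apply,
      ContinuousLinearMap.smul_apply, ContinuousLinearMap.sum_apply, hw, smul_eq_mul, Function.comp_apply]
    rw [← hqdef]
    have : ((q⁻¹ • M).mulVec v) i = q⁻¹ * (∑ j, (B * chartC n) i.succ j * v j)
        - q⁻¹ * (q⁻¹ * (∑ k, ∑ j, (B * chartC n) k j * v j) * B.mulVec (chartE u) i.succ) := by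
      have hMij : ∀ j, M i j * v j = (B * chartC n) i.succ j * v j -
          ∑ k, q⁻¹ * ((B * chartC n) k j * v j) * B.mulVec (chartE u) i.succ := by
        intro j
        rw [← Finset.sum_mul, ← Finset.mul_sum, ← Finset.sum_mul, hM, Matrix.of_apply]; ring
      have h0 : ((q⁻¹ • M).mulVec v) i = q⁻¹ * ∑ j, M i j * v j := by
        rw [Matrix.smul_mulVec]; rfl
      rw [h0, ← mul_sub]
      congr 1
      rw [Finset.sum_congr rfl fun j _ => hMij j, Finset.sum_sub_distrib]
      congr 1
      rw [Finset.sum_comm, Finset.mul_sum, Finset.sum_mul]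
      refine Finset.sum_congr rfl fun k _ => ?_
      rw [Finset.mul_sum, Finset.sum_mul]
    rw [this]
    field_simp
    ring
  · rw [ContinuousLinearMap.det, LinearMap.coe_toContinuousLinearMap, LinearMap.det_toLin',
      Matrix.det_smul, Fintype.card_fin, ← hMdet, inv_pow, pow_succ]
    field_simp

/-- change of variables on the simplex -/
lemma proj_change_of_variables {n : ℕ} (B : Matrix (Fin (n+1)) (Fin (n+1)) ℝ)
    (D : Set (Fin (n+1) → ℝ)) (hD : MeasurableSet D) (hDs : ∀ y ∈ D, ∑ i, y i = 1)
    (hq : ∀ y ∈ D, 0 < ∑ i, B.mulVec y i) (hinj : Set.InjOn (projNormalize B) D)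
    (g : (Fin (n+1) → ℝ) → ℝ≥0∞) :
    ∫⁻ x in projNormalize B '' D, g x ∂μH[(n:ℝ)] =
      ∫⁻ y in D, ENNReal.ofReal (projJac B y) * g (projNormalize B y) ∂μH[(n:ℝ)] := by
  obtain ⟨c, hc⟩ := chart_measure n
  set H : Set (Fin (n+1) → ℝ) := {x | ∑ i, x i = 1} with hH
  have hsum : ∀ y ∈ D, ∑ i, projNormalize B y i = 1 := by
    intro y hy
    simp only [projNormalize, Pi.smul_apply, smul_eq_mul, ← Finset.mul_sum]
    exact inv_mul_cancel₀ (hq y hy).ne'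
  have key : ∀ S : Set (Fin (n+1) → ℝ), S ⊆ H → ∀ h : (Fin (n+1) → ℝ) → ℝ≥0∞,
      ∫⁻ x in S, h x ∂μH[(n:ℝ)] = c * ∫⁻ u in chartE ⁻¹' S, h (chartE u) := by
    intro S hS h
    have : (μH[(n:ℝ)] : Measure (Fin (n+1) → ℝ)).restrict S = (μH[(n:ℝ)].restrict H).restrict S := by
      rw [Measure.restrict_restrict_of_subset hS]
    rw [this, hc, Measure.restrict_smul, lintegral_smul_measure, chartE_embedding.restrict_map,
      chartE_embedding.lintegral_map]
    rfl
  rw [key D (fun y hy => hDs y hy), key _ (by rintro _ ⟨y, hy, rfl⟩; exact hsum y hy)]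
  congr 1
  have hq' : ∀ u ∈ chartE ⁻¹' D, ∑ i, B.mulVec (chartE u) i ≠ 0 := fun u hu => (hq _ hu).ne'
  have hex : ∀ u, ∃ f' : (Fin n → ℝ) →L[ℝ] (Fin n → ℝ), u ∈ chartE ⁻¹' D →
      (HasFDerivAt (fun u => chartP (projNormalize B (chartE u))) f' u ∧
      f'.det = B.det / (∑ i, B.mulVec (chartE u) i) ^ (n+1)) := by
    intro u
    by_cases hu : u ∈ chartE ⁻¹' D
    · obtain ⟨f', h⟩ := chart_hasFDerivAt B u (hq' u hu)
      exact ⟨f', fun _ => h⟩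
    · exact ⟨0, fun h => absurd h hu⟩
  choose f' hf' using hex
  have himg : chartE ⁻¹' (projNormalize B '' D) =
      (fun u => chartP (projNormalize B (chartE u))) '' (chartE ⁻¹' D) := by
    ext u; constructor
    · rintro ⟨y, hy, hyu⟩
      refine ⟨chartP y, ?_, ?_⟩
      · simpa [chartE_chartP y (hDs y hy)] using hy
      · simp only [chartE_chartP y (hDs y hy), hyu, chartP_chartE]
    · rintro ⟨v, hv, rfl⟩
      exact ⟨chartE v, hv, (chartE_chartP _ (hsum _ hv)).symm⟩
  have hmeas : MeasurableSet (chartE ⁻¹' D) := continuous_chartE.measurable hD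
  have hinj' : Set.InjOn (fun u => chartP (projNormalize B (chartE u))) (chartE ⁻¹' D) := by
    intro u hu v hv huv
    have h1 := congrArg chartE huv
    try simp only at h1
    rw [chartE_chartP _ (hsum _ hu), chartE_chartP _ (hsum _ hv)] at h1
    exact chartE_embedding.injective (hinj hu hv h1)
  rw [himg, lintegral_image_eq_lintegral_abs_det_fderiv_mul volume hmeas
    (fun u hu => (hf' u hu).1.hasFDerivWithinAt) hinj']
  refine setLIntegral_congr_fun hmeas fun u hu => ?_
  rw [chartE_chartP _ (hsum _ hu), (hf' u hu).2, projJac, abs_div,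
    abs_of_pos (pow_pos (hq _ hu) _)]

lemma simplex_measure_lt_top {n : ℕ} (D : Set (Fin (n+1) → ℝ)) (hDs : D ⊆ openStdSimplex (n+1)) :
    (μH[(n:ℝ)] : Measure (Fin (n+1) → ℝ)) D < ∞ := by
  obtain ⟨c, hc⟩ := chart_measure n
  have : μH[(n:ℝ)] D ≤ (μH[(n:ℝ)] : Measure (Fin (n+1) → ℝ)).restrict {x | ∑ i, x i = 1} D := by
    rw [Measure.restrict_eq_self]
    exact fun y hy => (hDs hy).2
  refine lt_of_le_of_lt this ?_
  rw [hc]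
  simp only [Measure.smul_apply, chartE_embedding.map_apply]
  refine ENNReal.mul_lt_top (by simp) ?_
  refine lt_of_le_of_lt (measure_mono (t := Set.Icc 0 1) ?_) isCompact_Icc.measure_lt_top
  intro u hu
  have h := hDs hu
  have h2 : ∀ i : Fin n, u i = chartE u i.succ := fun i => rfl
  refine ⟨fun i => ?_, fun i => ?_⟩
  · rw [h2]; exact (h.1 _).le
  · rw [h2]
    have := Finset.single_le_sum (f := chartE u) (fun j _ => (h.1 j).le) (Finset.mem_univ i.succ)
    rw [h.2] at this; exact this

/-- Transfer operator. -/
noncomputable def transferOp {p : ℕ} (B : ℤ → Matrix (Fin p) (Fin p) ℝ)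
    (g : (Fin p → ℝ) → ℝ≥0∞) (y : Fin p → ℝ) : ℝ≥0∞ :=
  ∑' l, ENNReal.ofReal (projJac (B l) y) * g (projNormalize (B l) y)

/-- Bounded distortion with respect to the projective order. -/
def Distort {p : ℕ} (K : Set (Fin p → ℝ)) (g : (Fin p → ℝ) → ℝ≥0∞) : Prop :=
  ∀ y ∈ K, ∀ y' ∈ K, ∀ t : ℝ, 0 < t → (∀ i, y' i ≤ t * y i) → g y ≤ ENNReal.ofReal (t ^ p) * g y'

lemma mulVec_sum_pos {p : ℕ} (B : Matrix (Fin p) (Fin p) ℝ) (hB : IsUnit B)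
    (hBn : ∀ i j, 0 ≤ B i j) (y : Fin p → ℝ) (hy : y ∈ openStdSimplex p) :
    0 < ∑ i, B.mulVec y i := by
  have h0 : ∀ i, 0 ≤ B.mulVec y i := by
    intro i
    show 0 ≤ ∑ j, B i j * y j
    exact Finset.sum_nonneg fun j _ => mul_nonneg (hBn i j) (hy.1 j).le
  refine lt_of_le_of_ne (Finset.sum_nonneg fun i _ => h0 i) fun h => ?_
  have h1 : ∀ i, B.mulVec y i = 0 := by
    intro i
    exact (Finset.sum_eq_zero_iff_of_nonneg fun i _ => h0 i).1 h.symm i (Finset.mem_univ i)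
  have h2 : B.mulVec y = B.mulVec 0 := by
    rw [Matrix.mulVec_zero]; ext i; exact h1 i
  have h3 : y = 0 := Matrix.mulVec_injective_of_isUnit hB h2
  have := hy.2
  rw [h3] at this
  simp at this

lemma measurable_sumMulVec {p : ℕ} (B : Matrix (Fin p) (Fin p) ℝ) :
    Continuous fun y : Fin p → ℝ => ∑ i, B.mulVec y i := by
  fun_prop

lemma measurable_projNormalize {p : ℕ} (B : Matrix (Fin p) (Fin p) ℝ) :
    Measurable (projNormalize B) := by
  unfold projNormalize
  have h1 := (measurable_sumMulVec B).measurable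
  have h2 : Measurable fun y : Fin p → ℝ => B.mulVec y :=
    (by fun_prop : Continuous fun y : Fin p → ℝ => B.mulVec y).measurable
  exact h1.inv.smul h2

lemma measurable_projJac {p : ℕ} (B : Matrix (Fin p) (Fin p) ℝ) :
    Measurable (projJac B) := by
  unfold projJac
  exact ((measurable_sumMulVec B).measurable.pow_const p).const_div _

lemma measurable_transferOp {p : ℕ} (B : ℤ → Matrix (Fin p) (Fin p) ℝ)
    {g : (Fin p → ℝ) → ℝ≥0∞} (hg : Measurable g) : Measurable (transferOp B g) := by
  unfold transferOp
  exact Measurable.ennreal_tsum fun l =>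
    (measurable_projJac (B l)).ennreal_ofReal.mul (hg.comp (measurable_projNormalize (B l)))

lemma continuousOn_projNormalize {p : ℕ} (B : Matrix (Fin p) (Fin p) ℝ) (K : Set (Fin p → ℝ))
    (hK : ∀ y ∈ K, 0 < ∑ i, B.mulVec y i) : ContinuousOn (projNormalize B) K := by
  unfold projNormalize
  refine ContinuousOn.smul (ContinuousOn.inv₀ (measurable_sumMulVec B).continuousOn
    fun y hy => (hK y hy).ne') ?_
  exact (by fun_prop : Continuous fun y : Fin p → ℝ => B.mulVec y).continuousOn

lemma transferOp_distort {p : ℕ} (B : ℤ → Matrix (Fin p) (Fin p) ℝ)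
    (hB : ∀ l, IsUnit (B l)) (hBn : ∀ l i j, 0 ≤ B l i j) (K : Set (Fin p → ℝ))
    (hK : K ⊆ openStdSimplex p) (hmaps : ∀ l, Set.MapsTo (projNormalize (B l)) K K)
    (g : (Fin p → ℝ) → ℝ≥0∞) (hg : Distort K g) : Distort K (transferOp B g) := by
  intro y hy y' hy' t ht htt
  unfold transferOp
  rw [← ENNReal.tsum_mul_left]
  refine ENNReal.tsum_le_tsum fun l => ?_
  have hq := mulVec_sum_pos (B l) (hB l) (hBn l) y (hK hy)
  have hq' := mulVec_sum_pos (B l) (hB l) (hBn l) y' (hK hy')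
  set q := ∑ i, (B l).mulVec y i with hqd
  set q' := ∑ i, (B l).mulVec y' i with hqd'
  have h1 : ∀ i, (B l).mulVec y' i ≤ t * (B l).mulVec y i := by
    intro i
    simp only [Matrix.mulVec, dotProduct, Finset.mul_sum]
    refine Finset.sum_le_sum fun j _ => ?_
    calc B l i j * y' j ≤ B l i j * (t * y j) := mul_le_mul_of_nonneg_left (htt j) (hBn l i j)
      _ = _ := by ring
  have h2 : ∀ i, projNormalize (B l) y' i ≤ (t * q / q') * projNormalize (B l) y i := by
    intro i
    simp only [projNormalize, Pi.smul_apply, smul_eq_mul]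
    rw [← hqd, ← hqd']
    calc q'⁻¹ * (B l).mulVec y' i ≤ q'⁻¹ * (t * (B l).mulVec y i) :=
          mul_le_mul_of_nonneg_left (h1 i) (by positivity)
      _ = _ := by field_simp
  have h3 := hg _ (hmaps l hy) _ (hmaps l hy') (t * q / q') (by positivity) h2
  calc _ ≤ ENNReal.ofReal (projJac (B l) y) *
        (ENNReal.ofReal ((t * q / q') ^ p) * g (projNormalize (B l) y')) := by gcongr
    _ = ENNReal.ofReal (projJac (B l) y * (t * q / q') ^ p) * g (projNormalize (B l) y') := by
      rw [← mul_assoc, ← ENNReal.ofReal_mul]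
      unfold projJac; positivity
    _ = ENNReal.ofReal (t ^ p * projJac (B l) y') * g (projNormalize (B l) y') := by
      congr 2
      simp only [projJac]
      rw [← hqd, ← hqd', div_pow, mul_pow]
      field_simp
    _ = _ := by rw [← mul_assoc, ENNReal.ofReal_mul (by positivity)]

lemma one_distort {p : ℕ} (K : Set (Fin p → ℝ))
    (hK : K ⊆ openStdSimplex p) : Distort K (fun _ => 1) := by
  intro y hy y' hy' t ht htt
  have : 1 ≤ t := by
    calc 1 = ∑ i, y' i := (hK hy').2.symm
      _ ≤ ∑ i, t * y i := Finset.sum_le_sum fun i _ => htt i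
      _ = t := by rw [← Finset.mul_sum, (hK hy).2, mul_one]
  simp only [mul_one]
  rw [ENNReal.one_le_ofReal]
  exact one_le_pow₀ this

lemma transferOp_liminf {p : ℕ} (B : ℤ → Matrix (Fin p) (Fin p) ℝ)
    (g : ℕ → (Fin p → ℝ) → ℝ≥0∞) (y : Fin p → ℝ) :
    transferOp B (fun x => Filter.liminf (fun k => g k x) Filter.atTop) y ≤
      Filter.liminf (fun k => transferOp B (g k) y) Filter.atTop := by
  unfold transferOp
  simp only [← lintegral_count]
  refine le_trans (lintegral_mono fun l => ?_) (lintegral_liminf_le fun k => measurable_from_top)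
  exact (ENNReal.liminf_const_mul_of_ne_top ENNReal.ofReal_ne_top).ge

lemma distort_liminf {p : ℕ} (K : Set (Fin p → ℝ)) (g : ℕ → (Fin p → ℝ) → ℝ≥0∞)
    (hg : ∀ k, Distort K (g k)) :
    Distort K (fun x => Filter.liminf (fun k => g k x) Filter.atTop) := by
  intro y hy y' hy' t ht htt
  simp only
  rw [← ENNReal.liminf_const_mul_of_ne_top ENNReal.ofReal_ne_top]
  exact Filter.liminf_le_liminf (Filter.Eventually.of_forall fun k => hg k y hy y' hy' t ht htt)

/-- Distortion and a finite bound imply continuity. -/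
lemma distort_continuousOn {p : ℕ} (K : Set (Fin p → ℝ)) (δ : ℝ) (hδ : 0 < δ)
    (hK : ∀ y ∈ K, ∀ i, δ ≤ y i) (g : (Fin p → ℝ) → ℝ≥0∞) (hg : Distort K g)
    (hfin : ∀ y ∈ K, g y ≠ ∞) : ContinuousOn (fun y => (g y).toReal) K := by
  have hle : ∀ y ∈ K, ∀ y' ∈ K, (g y).toReal ≤ (1 + dist y y' / δ) ^ p * (g y').toReal := by
    intro y hy y' hy'
    have := hg y hy y' hy' (1 + dist y y' / δ) (by positivity) (fun i => by
      have h1 := dist_le_pi_dist y y' i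
      rw [Real.dist_eq] at h1
      have h2 := neg_abs_le (y i - y' i)
      have h3 := hK y hy i
      have h4 : dist y y' ≤ dist y y' / δ * y i := by
        rw [div_mul_eq_mul_div, le_div_iff₀ hδ]
        exact mul_le_mul_of_nonneg_left h3 dist_nonneg
      linarith)
    have h5 := ENNReal.toReal_mono (ENNReal.mul_ne_top ENNReal.ofReal_ne_top (hfin y' hy')) this
    rwa [ENNReal.toReal_mul, ENNReal.toReal_ofReal (by positivity)] at h5
  intro a ha
  have hd : Filter.Tendsto (fun y => (1 + dist y a / δ) ^ p) (nhdsWithin a K) (nhds 1) := by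
    have : Continuous fun y => (1 + dist y a / δ) ^ p := by fun_prop
    have h := this.continuousWithinAt (s := K) (x := a)
    simpa [ContinuousWithinAt] using h
  have hpos : ∀ y, 0 < (1 + dist y a / δ) ^ p := fun y => by positivity
  refine tendsto_of_tendsto_of_tendsto_of_le_of_le'
    (g := fun y => ((1 + dist y a / δ) ^ p)⁻¹ * (g a).toReal)
    (h := fun y => ((1 + dist y a / δ) ^ p) * (g a).toReal) ?_ ?_ ?_ ?_
  · simpa using (hd.inv₀ one_ne_zero).mul_const (g a).toReal
  · simpa using hd.mul_const (g a).toReal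
  · filter_upwards [self_mem_nhdsWithin] with y hy
    rw [inv_mul_le_iff₀ (hpos y), dist_comm]
    exact hle a ha y hy
  · filter_upwards [self_mem_nhdsWithin] with y hy
    exact hle y hy a ha

lemma transfer_integral {n : ℕ}
    (Δ : Set (Fin (n+1) → ℝ)) (hΔmeas : MeasurableSet Δ)
    (hΔs : Δ ⊆ openStdSimplex (n+1))
    (leb : Measure (Fin (n+1) → ℝ)) (hleb : leb = (μH[(n : ℝ)]).restrict Δ)
    (Δl : ℤ → Set (Fin (n+1) → ℝ)) (hΔlmeas : ∀ l, MeasurableSet (Δl l))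
    (hΔlsub : ∀ l, Δl l ⊆ Δ)
    (hΔldisj : Pairwise (Function.onFun Disjoint Δl))
    (hΔlcover : leb (Δ \ ⋃ l, Δl l) = 0)
    (T : (Fin (n+1) → ℝ) → (Fin (n+1) → ℝ))
    (hTbij : ∀ l, Set.BijOn T (Δl l) Δ)
    (B : ℤ → Matrix (Fin (n+1)) (Fin (n+1)) ℝ) (hB : ∀ l, IsUnit (B l))
    (hBn : ∀ l i j, 0 ≤ B l i j)
    (hTB : ∀ l, ∀ y ∈ Δ, projNormalize (B l) y ∈ Δl l ∧ T (projNormalize (B l) y) = y)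
    (G g : (Fin (n+1) → ℝ) → ℝ≥0∞) (hG : Measurable G) (hg : Measurable g) :
    ∫⁻ x, G (T x) * g x ∂leb = ∫⁻ y, G y * transferOp B g y ∂leb := by
  have hU : leb = (μH[(n:ℝ)]).restrict (⋃ l, Δl l) := by
    rw [hleb]
    refine Measure.restrict_congr_set ?_
    refine Filter.EventuallyLE.antisymm ?_ (Set.iUnion_subset hΔlsub).eventuallyLE
    rw [ae_le_set]
    rw [hleb, Measure.restrict_apply' hΔmeas] at hΔlcover
    rwa [Set.inter_eq_left.2 Set.diff_subset] at hΔlcover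
  have himg : ∀ l, projNormalize (B l) '' Δ = Δl l := by
    intro l
    refine Set.Subset.antisymm ?_ ?_
    · rintro _ ⟨y, hy, rfl⟩; exact (hTB l y hy).1
    · intro x hx
      have hy := (hTbij l).mapsTo hx
      exact ⟨T x, hy, (hTbij l).injOn (hTB l _ hy).1 hx (hTB l _ hy).2⟩
  conv_lhs => rw [hU, lintegral_iUnion hΔlmeas hΔldisj]
  have h1 : ∀ l, ∫⁻ x in Δl l, G (T x) * g x ∂μH[(n:ℝ)] =
      ∫⁻ y, G y * (ENNReal.ofReal (projJac (B l) y) * g (projNormalize (B l) y)) ∂leb := by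
    intro l
    rw [← himg l, proj_change_of_variables (B l) Δ hΔmeas (fun y hy => (hΔs hy).2)
      (fun y hy => mulVec_sum_pos _ (hB l) (hBn l) y (hΔs hy))
      (fun y hy y' hy' h => by
        rw [← (hTB l y hy).2, ← (hTB l y' hy').2, h]), hleb]
    refine setLIntegral_congr_fun hΔmeas fun y hy => ?_
    simp only [(hTB l y hy).2]
    ring
  simp only [h1]
  rw [← lintegral_tsum]
  · simp only [transferOp, ENNReal.tsum_mul_left]
  · intro l
    exact (hG.mul ((measurable_projJac (B l)).ennreal_ofReal.mul
      (hg.comp (measurable_projNormalize (B l))))).aemeasurable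

/-- Let `Δ` be a simplex compactly contained in the standard open simplex, `{Δl l}` a countable
partition of `Δ` (mod 0) into sets of positive Lebesgue measure, and `T : Δ → Δ` a measurable map
sending each `Δl l` bijectively onto `Δ` with inverse branch the restriction of a projective
contraction. Then `T` preserves a probability measure `μ` absolutely continuous with respect to
Lebesgue measure on `Δ`, whose density is continuous and positive on the closure of `Δ`. -/
theorem exists_invariant_acip_of_projective_branches
    {p : ℕ} (hp : 2 ≤ p)
    (Δ : Set (Fin p → ℝ)) (hΔmeas : MeasurableSet Δ)
    (hΔcc : closure Δ ⊆ openStdSimplex p)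
    -- Δ is a simplex: the image of the standard simplex under a projective contraction
    (C : Matrix (Fin p) (Fin p) ℝ) (hCinv : IsUnit C) (hCnonneg : ∀ i j, 0 ≤ C i j)
    (hΔsimplex : Δ = projNormalize C '' openStdSimplex p)
    -- Lebesgue measure on the simplex: (p-1)-dimensional Hausdorff measure restricted to Δ
    (leb : Measure (Fin p → ℝ)) (hleb : leb = (μH[(p : ℝ) - 1]).restrict Δ)
    (Δl : ℤ → Set (Fin p → ℝ)) (hΔlmeas : ∀ l, MeasurableSet (Δl l))
    (hΔlsub : ∀ l, Δl l ⊆ Δ) (hΔlpos : ∀ l, 0 < leb (Δl l))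
    (hΔldisj : Pairwise (Function.onFun Disjoint Δl))
    (hΔlcover : leb (Δ \ ⋃ l, Δl l) = 0)
    (T : (Fin p → ℝ) → (Fin p → ℝ)) (hTmeas : Measurable T)
    (hTbij : ∀ l, Set.BijOn T (Δl l) Δ)
    (hTbranch : ∀ l, ∃ B : Matrix (Fin p) (Fin p) ℝ, IsUnit B ∧ (∀ i j, 0 ≤ B i j) ∧
      ∀ y ∈ Δ, projNormalize B y ∈ Δl l ∧ T (projNormalize B y) = y) :
    ∃ μ : Measure (Fin p → ℝ), IsProbabilityMeasure μ ∧ μ.map T = μ ∧ μ ≪ leb ∧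
      ∃ f : (Fin p → ℝ) → ℝ, ContinuousOn f (closure Δ) ∧ (∀ x ∈ closure Δ, 0 < f x) ∧
        μ = leb.withDensity (fun x => ENNReal.ofReal (f x)) := by
  obtain ⟨n, rfl⟩ : ∃ n, p = n + 1 := ⟨p - 1, by omega⟩
  have hcast : (((n + 1 : ℕ) : ℝ) - 1) = (n : ℝ) := by push_cast; ring
  rw [hcast] at hleb
  choose B hB hBn hTB using hTbranch
  set K := closure Δ with hKdef
  have hΔK : Δ ⊆ K := subset_closure
  have hΔs : Δ ⊆ openStdSimplex (n+1) := hΔK.trans hΔcc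
  -- basic facts on `leb`
  have hlebmem : ∀ᵐ x ∂leb, x ∈ Δ := by
    rw [hleb]; exact ae_restrict_mem hΔmeas
  have hVtop : leb Set.univ < ∞ := by
    rw [hleb, Measure.restrict_apply_univ]; exact simplex_measure_lt_top Δ hΔs
  have hVpos : 0 < leb Set.univ := lt_of_lt_of_le (hΔlpos 0) (measure_mono (Set.subset_univ _))
  have hne : K.Nonempty := by
    have : (Δl 0).Nonempty := nonempty_of_measure_ne_zero (hΔlpos 0).ne'
    exact this.mono ((hΔlsub 0).trans hΔK)
  -- compactness
  have hKc : IsCompact K := by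
    refine IsCompact.of_isClosed_subset (isCompact_Icc (a := (0 : Fin (n+1) → ℝ)) (b := 1))
      isClosed_closure fun y hy => ?_
    have h := hΔcc hy
    refine ⟨fun i => (h.1 i).le, fun i => ?_⟩
    have := Finset.single_le_sum (f := y) (fun j _ => (h.1 j).le) (Finset.mem_univ i)
    rw [h.2] at this; exact this
  obtain ⟨δ, hδ, hδK⟩ : ∃ δ : ℝ, 0 < δ ∧ ∀ y ∈ K, ∀ i, δ ≤ y i := by
    have h1 : ∀ i : Fin (n+1), ∃ d : ℝ, 0 < d ∧ ∀ y ∈ K, d ≤ y i := by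
      intro i
      obtain ⟨y0, hy0, hmin⟩ := hKc.exists_isMinOn hne (continuous_apply i).continuousOn
      exact ⟨y0 i, (hΔcc hy0).1 i, fun y hy => hmin hy⟩
    choose d hd hdK using h1
    obtain ⟨i0, -, hi0⟩ := Finset.exists_min_image Finset.univ d Finset.univ_nonempty
    exact ⟨d i0, hd i0, fun y hy i => (hi0 i (Finset.mem_univ i)).trans (hdK i y hy)⟩
  have hmaps : ∀ l, Set.MapsTo (projNormalize (B l)) K K := by
    intro l
    have h1 : Set.MapsTo (projNormalize (B l)) Δ Δ := fun y hy => hΔlsub l (hTB l y hy).1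
    exact h1.closure_of_continuousOn (continuousOn_projNormalize _ _
      fun y hy => mulVec_sum_pos _ (hB l) (hBn l) y (hΔcc hy))
  have hint := transfer_integral Δ hΔmeas hΔs leb hleb Δl hΔlmeas hΔlsub hΔldisj hΔlcover T hTbij
    B hB hBn hTB
  have hint1 : ∀ g : (Fin (n+1) → ℝ) → ℝ≥0∞, Measurable g →
      ∫⁻ y, transferOp B g y ∂leb = ∫⁻ y, g y ∂leb := by
    intro g hg
    have := hint (fun _ => 1) g measurable_const hg
    simpa using this.symm
  -- iterates of the transfer operator
  set g : ℕ → (Fin (n+1) → ℝ) → ℝ≥0∞ := fun k => (transferOp B)^[k] (fun _ => 1) with hgdef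
  have hgs : ∀ k, g (k+1) = transferOp B (g k) := fun k => Function.iterate_succ_apply' _ _ _
  have hgm : ∀ k, Measurable (g k) := by
    intro k
    induction k with
    | zero => exact measurable_const
    | succ k ih => rw [hgs]; exact measurable_transferOp B ih
  have hgd : ∀ k, Distort K (g k) := by
    intro k
    induction k with
    | zero => exact one_distort K hΔcc
    | succ k ih => rw [hgs]; exact transferOp_distort B hB hBn K hΔcc hmaps _ ih
  have hgi : ∀ k, ∫⁻ y, g k y ∂leb = leb Set.univ := by
    intro k
    induction k with
    | zero => simp [hgdef]
    | succ k ih => rw [hgs, hint1 _ (hgm k), ih]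
  set D : ℝ≥0∞ := ENNReal.ofReal ((1 / δ) ^ (n+1)) with hD
  have hDtop : D ≠ ∞ := ENNReal.ofReal_ne_top
  have hD0 : D ≠ 0 := (ENNReal.ofReal_pos.2 (by positivity)).ne'
  have hgD : ∀ k, ∀ y ∈ K, ∀ y' ∈ K, g k y ≤ D * g k y' := by
    intro k y hy y' hy'
    refine hgd k y hy y' hy' (1 / δ) (by positivity) fun i => ?_
    have h := hΔcc hy'
    have h1 := Finset.single_le_sum (f := y') (fun j _ => (h.1 j).le) (Finset.mem_univ i)
    rw [h.2] at h1
    refine h1.trans ?_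
    rw [div_mul_eq_mul_div, le_div_iff₀ hδ]
    simpa using hδK y hy i
  have hup : ∀ k, ∀ y ∈ K, g k y ≤ D := by
    intro k y hy
    have h : ∫⁻ _, g k y ∂leb ≤ ∫⁻ y', D * g k y' ∂leb := by
      refine lintegral_mono_ae ?_
      filter_upwards [hlebmem] with y' hy'
      exact hgD k y hy y' (hΔK hy')
    rw [lintegral_const, lintegral_const_mul _ (hgm k), hgi] at h
    exact (ENNReal.mul_le_mul_iff_left hVpos.ne' hVtop.ne).1 h
  have hlow : ∀ k, ∀ y ∈ K, D⁻¹ ≤ g k y := by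
    intro k y hy
    have h : ∫⁻ y', g k y' ∂leb ≤ ∫⁻ _, D * g k y ∂leb := by
      refine lintegral_mono_ae ?_
      filter_upwards [hlebmem] with y' hy'
      exact hgD k y' (hΔK hy') y hy
    rw [lintegral_const, hgi] at h
    have h2 : 1 ≤ D * g k y := by
      refine (ENNReal.mul_le_mul_iff_left hVpos.ne' hVtop.ne).1 ?_
      rwa [one_mul]
    rw [ENNReal.inv_le_iff_le_mul (fun _ => hD0) (fun h => absurd h hDtop)]
    exact h2
  -- the invariant density
  set f : (Fin (n+1) → ℝ) → ℝ≥0∞ := fun x => Filter.liminf (fun k => g k x) Filter.atTop with hf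
  have hfm : Measurable f := Measurable.liminf hgm
  have hfd : Distort K f := distort_liminf K g hgd
  have hfT : ∀ y, transferOp B f y ≤ f y := by
    intro y
    refine (transferOp_liminf B g y).trans ?_
    simp only [← hgs]
    exact (Filter.liminf_nat_add (fun k => g k y) 1).le
  have hfup : ∀ y ∈ K, f y ≤ D := by
    intro y hy
    exact (Filter.liminf_le_liminf (Filter.Eventually.of_forall fun k => hup k y hy)).trans
      (by simp)
  have hflow : ∀ y ∈ K, D⁻¹ ≤ f y := by
    intro y hy
    refine le_trans (by simp) (Filter.liminf_le_liminf (u := fun _ : ℕ => D⁻¹)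
      (Filter.Eventually.of_forall fun k => hlow k y hy))
  have hfpos : ∀ y ∈ K, 0 < f y := fun y hy =>
    lt_of_lt_of_le (ENNReal.inv_pos.2 hDtop) (hflow y hy)
  have hftop : ∀ y ∈ K, f y ≠ ∞ := fun y hy => ne_top_of_le_ne_top hDtop (hfup y hy)
  set m := ∫⁻ y, f y ∂leb with hm
  have hmtop : m ≠ ∞ := by
    have : m ≤ ∫⁻ _, D ∂leb := by
      refine lintegral_mono_ae ?_
      filter_upwards [hlebmem] with y hy using hfup y (hΔK hy)
    refine ne_top_of_le_ne_top ?_ this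
    rw [lintegral_const]
    exact ENNReal.mul_ne_top hDtop hVtop.ne
  have hmpos : m ≠ 0 := by
    have : ∫⁻ _, D⁻¹ ∂leb ≤ m := by
      refine lintegral_mono_ae ?_
      filter_upwards [hlebmem] with y hy using hflow y (hΔK hy)
    rw [lintegral_const] at this
    refine (lt_of_lt_of_le (ENNReal.mul_pos ?_ hVpos.ne') this).ne'
    exact (ENNReal.inv_pos.2 hDtop).ne'
  set F : (Fin (n+1) → ℝ) → ℝ := fun y => m.toReal⁻¹ * (f y).toReal with hF
  have hFpos : ∀ y ∈ K, 0 < F y := fun y hy =>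
    mul_pos (inv_pos.2 (ENNReal.toReal_pos hmpos hmtop))
      (ENNReal.toReal_pos (hfpos y hy).ne' (hftop y hy))
  have hFcont : ContinuousOn F K :=
    continuousOn_const.mul (distort_continuousOn K δ hδ hδK f hfd hftop)
  have hFf : ∀ y ∈ K, ENNReal.ofReal (F y) = m⁻¹ * f y := by
    intro y hy
    simp only [hF]
    rw [← ENNReal.toReal_inv, ← ENNReal.toReal_mul, ENNReal.ofReal_toReal]
    exact ENNReal.mul_ne_top (ENNReal.inv_ne_top.2 hmpos) (hftop y hy)
  have hwd : leb.withDensity (fun x => ENNReal.ofReal (F x)) =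
      leb.withDensity (fun x => m⁻¹ * f x) := by
    refine withDensity_congr_ae ?_
    filter_upwards [hlebmem] with y hy using hFf y (hΔK hy)
  have hprob : IsProbabilityMeasure (leb.withDensity (fun x => ENNReal.ofReal (F x))) := by
    refine ⟨?_⟩
    rw [hwd, withDensity_apply _ MeasurableSet.univ, Measure.restrict_univ,
      lintegral_const_mul _ hfm]
    exact ENNReal.inv_mul_cancel hmpos hmtop
  refine ⟨leb.withDensity (fun x => ENNReal.ofReal (F x)), hprob, ?_,
    withDensity_absolutelyContinuous _ _, F, hFcont, hFpos, rfl⟩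
  have hprob' : IsProbabilityMeasure
      ((leb.withDensity (fun x => ENNReal.ofReal (F x))).map T) :=
    Measure.isProbabilityMeasure_map hTmeas.aemeasurable
  refine Measure.eq_of_le_of_isProbabilityMeasure ?_
  rw [hwd]
  refine Measure.le_iff.2 fun S hS => ?_
  rw [Measure.map_apply hTmeas hS, withDensity_apply _ (hTmeas hS), withDensity_apply _ hS,
    lintegral_const_mul _ hfm, lintegral_const_mul _ hfm]
  refine mul_le_mul_right ?_ _
  have h1 := hint (S.indicator 1) f (measurable_one.indicator hS) hfm
  rw [← lintegral_indicator (hTmeas hS), ← lintegral_indicator hS]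
  calc ∫⁻ x, (T ⁻¹' S).indicator f x ∂leb = ∫⁻ x, S.indicator 1 (T x) * f x ∂leb := by
        refine lintegral_congr fun x => ?_
        by_cases hx : T x ∈ S <;> simp [Set.indicator, hx]
    _ = _ := h1
    _ ≤ ∫⁻ y, S.indicator f y ∂leb := by
        refine lintegral_mono fun y => ?_
        by_cases hy : y ∈ S <;> simp [Set.indicator, hy, hfT y]
end

section
/- Under the hypotheses of the previous statement, the invariant measure μ can be chosen so that T is strongly expanding: there is a constant K > 0 such that for every finite word ℓ of partition indices, the normalized push-forward measure μ^ℓ := (1/μ(Δ^ℓ)) (T^ℓ)_* μ has density with respect to μ bounded between K⁻¹ and K. -/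
open MeasureTheory
open scoped BigOperators ENNReal

/-- The cylinder `Δ^ℓ = {x : T^{k-1} x ∈ Δ^{(l_k)}, 1 ≤ k ≤ n}` for a finite word
`ℓ = (l_1, …, l_n)`. -/
def cylinder {β : Type*} (T : β → β) (Δl : ℤ → Set β) (ℓ : List ℤ) : Set β :=
  {x | ∀ k : Fin ℓ.length, T^[(k : ℕ)] x ∈ Δl (ℓ.get k)}

open Filter Topology in
lemma aux_exists_inv {X : Type*} [MeasurableSpace X] (lam : Measure X) [IsProbabilityMeasure lam]
    (T : X → X) (hT : Measurable T) (d : ℝ)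
    (hup : ∀ k s, MeasurableSet s → lam.real (T^[k] ⁻¹' s) ≤ d * lam.real s)
    (hlo : ∀ k s, MeasurableSet s → lam.real s ≤ d * lam.real (T^[k] ⁻¹' s)) :
    ∃ μ : Measure X, IsProbabilityMeasure μ ∧ μ.map T = μ ∧
      ∀ s, MeasurableSet s → μ.real s ≤ d * lam.real s ∧ lam.real s ≤ d * μ.real s := by
  classical
  let a : ℕ → Set X → ℝ := fun N s => ((N : ℝ) + 1)⁻¹ * ∑ k ∈ Finset.range (N + 1), lam.real (T^[k] ⁻¹' s)
  have hTk : ∀ k, Measurable (T^[k]) := fun k => hT.iterate k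
  have hN : ∀ N : ℕ, (0 : ℝ) < (N : ℝ) + 1 := fun N => by positivity
  have ha0 : ∀ N s, 0 ≤ a N s := fun N s => by
    have := hN N
    exact mul_nonneg (by positivity) (Finset.sum_nonneg fun _ _ => measureReal_nonneg)
  have ha1 : ∀ N s, a N s ≤ 1 := fun N s => by
    have h : ∑ k ∈ Finset.range (N + 1), lam.real (T^[k] ⁻¹' s) ≤ (N : ℝ) + 1 := by
      calc _ ≤ ∑ k ∈ Finset.range (N + 1), (1 : ℝ) := Finset.sum_le_sum fun _ _ => measureReal_le_one
        _ = _ := by simp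
    calc a N s ≤ ((N : ℝ) + 1)⁻¹ * ((N : ℝ) + 1) := by
          have := hN N
          exact mul_le_mul_of_nonneg_left h (by positivity)
      _ = 1 := inv_mul_cancel₀ (hN N).ne'
  have haup : ∀ N s, MeasurableSet s → a N s ≤ d * lam.real s := fun N s hs => by
    have h : ∑ k ∈ Finset.range (N + 1), lam.real (T^[k] ⁻¹' s) ≤ ((N : ℝ) + 1) * (d * lam.real s) := by
      calc _ ≤ ∑ k ∈ Finset.range (N + 1), (d * lam.real s) := Finset.sum_le_sum fun k _ => hup k s hs
        _ = _ := by simp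
    calc a N s ≤ ((N : ℝ) + 1)⁻¹ * (((N : ℝ) + 1) * (d * lam.real s)) := by
          have := hN N
          exact mul_le_mul_of_nonneg_left h (by positivity)
      _ = _ := inv_mul_cancel_left₀ (hN N).ne' _
  have halo : ∀ N s, MeasurableSet s → lam.real s ≤ d * a N s := fun N s hs => by
    have h : ((N : ℝ) + 1) * lam.real s ≤ d * ∑ k ∈ Finset.range (N + 1), lam.real (T^[k] ⁻¹' s) := by
      rw [Finset.mul_sum]
      calc ((N : ℝ) + 1) * lam.real s = ∑ k ∈ Finset.range (N + 1), (lam.real s) := by simp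
        _ ≤ _ := Finset.sum_le_sum fun k _ => hlo k s hs
    calc lam.real s = ((N : ℝ) + 1)⁻¹ * (((N : ℝ) + 1) * lam.real s) := (inv_mul_cancel_left₀ (hN N).ne' _).symm
      _ ≤ ((N : ℝ) + 1)⁻¹ * (d * ∑ k ∈ Finset.range (N + 1), lam.real (T^[k] ⁻¹' s)) := by
          have := hN N
          exact mul_le_mul_of_nonneg_left h (by positivity)
      _ = _ := by simp only [a]; ring
  let u : Ultrafilter ℕ := hyperfilter ℕ
  have hu : (u : Filter ℕ) ≤ atTop := by
    simpa [u] using (Nat.hyperfilter_le_atTop)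
  have hex : ∀ s, ∃ L, Tendsto (fun N => a N s) u (𝓝 L) := fun s => by
    have hc : IsCompact (Set.Icc (0 : ℝ) 1) := isCompact_Icc
    obtain ⟨L, -, hL⟩ := hc.ultrafilter_le_nhds (u.map fun N => a N s) (by
      rw [le_principal_iff]
      exact Filter.Eventually.of_forall (f := (u : Filter ℕ)) fun N => ⟨ha0 N s, ha1 N s⟩)
    exact ⟨L, hL⟩
  choose m hm using hex
  have hm0 : ∀ s, 0 ≤ m s := fun s => ge_of_tendsto' (hm s) fun N => ha0 N s
  have hmup : ∀ s, MeasurableSet s → m s ≤ d * lam.real s := fun s hs =>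
    le_of_tendsto' (hm s) fun N => haup N s hs
  have hmlo : ∀ s, MeasurableSet s → lam.real s ≤ d * m s := fun s hs =>
    ge_of_tendsto' ((hm s).const_mul d) fun N => halo N s hs
  have hmempty : m ∅ = 0 := le_antisymm (by simpa using hmup ∅ .empty) (hm0 _)
  have hmuniv : m Set.univ = 1 := by
    refine tendsto_nhds_unique (hm _) ?_
    have : (fun N => a N Set.univ) = fun _ => 1 := by
      funext N
      simp only [a, Set.preimage_univ, probReal_univ, Finset.sum_const, Finset.card_range, nsmul_eq_mul, mul_one]
      push_cast
      exact inv_mul_cancel₀ (hN N).ne'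
    rw [this]; exact tendsto_const_nhds
  have hlamsum : ∀ f : ℕ → Set X, (∀ i, MeasurableSet (f i)) → Pairwise (Function.onFun Disjoint f) →
      HasSum (fun i => lam.real (f i)) (lam.real (⋃ i, f i)) := fun f hf hd => by
    have h := measure_iUnion (μ := lam) hd hf
    have hne : ∑' i, lam (f i) ≠ ⊤ := by rw [← h]; exact measure_ne_top _ _
    have := ENNReal.hasSum_toReal hne
    rwa [← ENNReal.tsum_toReal_eq (fun i => measure_ne_top _ _), ← h] at this
  have hasum : ∀ N, ∀ f : ℕ → Set X, (∀ i, MeasurableSet (f i)) → Pairwise (Function.onFun Disjoint f) →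
      HasSum (fun i => a N (f i)) (a N (⋃ i, f i)) := fun N f hf hd => by
    refine HasSum.mul_left _ (hasSum_sum fun k _ => ?_)
    rw [Set.preimage_iUnion]
    exact hlamsum _ (fun i => hTk k (hf i)) fun i j hij => (hd hij).preimage _
  have hmsum : ∀ f : ℕ → Set X, (∀ i, MeasurableSet (f i)) → Pairwise (Function.onFun Disjoint f) →
      m (⋃ i, f i) = ∑' i, m (f i) ∧ Summable (fun i => m (f i)) := fun f hf hd => by
    have hs : Summable fun i => d * lam.real (f i) := (hlamsum f hf hd).summable.mul_left d
    refine ⟨?_, Summable.of_nonneg_of_le (fun i => hm0 _) (fun i => hmup _ (hf i)) hs⟩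
    refine tendsto_nhds_unique (hm _) ?_
    have := tendsto_tsum_of_dominated_convergence (𝓕 := (u : Filter ℕ)) (f := fun N i => a N (f i))
      (g := fun i => m (f i)) hs (fun i => hm (f i)) (Eventually.of_forall fun N i => by
        rw [Real.norm_of_nonneg (ha0 _ _)]; exact haup N _ (hf i))
    simpa only [(hasum _ f hf hd).tsum_eq] using this
  let μ : Measure X := Measure.ofMeasurable (fun s _ => ENNReal.ofReal (m s)) (by simp [hmempty])
    (fun f hf hd => by
      rw [(hmsum f hf hd).1, ENNReal.ofReal_tsum_of_nonneg (fun _ => hm0 _) (hmsum f hf hd).2])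
  have hμ : ∀ s, MeasurableSet s → μ s = ENNReal.ofReal (m s) := fun s hs =>
    Measure.ofMeasurable_apply s hs
  have hμr : ∀ s, MeasurableSet s → μ.real s = m s := fun s hs => by
    rw [measureReal_def, hμ s hs, ENNReal.toReal_ofReal (hm0 s)]
  refine ⟨μ, ⟨by rw [hμ _ .univ, hmuniv]; simp⟩, ?_, fun s hs => ?_⟩
  · ext s hs
    rw [Measure.map_apply hT hs, hμ _ hs, hμ _ (hT hs)]
    congr 1
    have hdiff : Tendsto (fun N => a N (T ⁻¹' s) - a N s) u (𝓝 0) := by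
      have h0 : Tendsto (fun N : ℕ => 1 / ((N : ℝ) + 1)) u (𝓝 0) :=
        tendsto_one_div_add_atTop_nhds_zero_nat.mono_left hu
      refine squeeze_zero_norm (fun N => ?_) h0
      have e : a N (T ⁻¹' s) - a N s = ((N : ℝ) + 1)⁻¹ * (lam.real (T^[N+1] ⁻¹' s) - lam.real s) := by
        simp only [a]
        rw [← mul_sub, ← Finset.sum_sub_distrib]
        congr 1
        have := Finset.sum_range_sub (fun k => lam.real (T^[k] ⁻¹' s)) (N+1)
        simp only [Function.iterate_zero, Set.preimage_id] at this
        rw [← this]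
        refine Finset.sum_congr rfl fun k _ => ?_
        rw [← Set.preimage_comp, ← Function.iterate_succ']
      rw [e, norm_mul, Real.norm_of_nonneg (inv_nonneg.2 (hN N).le), one_div]
      refine mul_le_of_le_one_right (inv_nonneg.2 (hN N).le) ?_
      have h1 := measureReal_le_one (μ := lam) (s := T^[N+1] ⁻¹' s)
      have h2 := measureReal_le_one (μ := lam) (s := s)
      have h3 := measureReal_nonneg (μ := lam) (s := T^[N+1] ⁻¹' s)
      have h4 := measureReal_nonneg (μ := lam) (s := s)
      rw [Real.norm_eq_abs, abs_le]; constructor <;> linarith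
    have := tendsto_nhds_unique ((hm (T ⁻¹' s)).sub (hm s)) hdiff
    linarith
  · rw [hμr s hs]; exact ⟨hmup s hs, hmlo s hs⟩
lemma aux_cyl_meas {X : Type*} [MeasurableSpace X] {T : X → X} (hT : Measurable T) {Δl : ℤ → Set X}
    (hΔl : ∀ l, MeasurableSet (Δl l)) (ℓ : List ℤ) : MeasurableSet (cylinder T Δl ℓ) := by
  have : cylinder T Δl ℓ = ⋂ k : Fin ℓ.length, T^[(k : ℕ)] ⁻¹' Δl (ℓ.get k) := by
    ext x; simp [_root_.cylinder]
  rw [this]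
  exact MeasurableSet.iInter fun k => hT.iterate k (hΔl _)

lemma aux_abstract {X : Type*} [MeasurableSpace X] (lam : Measure X) [IsProbabilityMeasure lam]
    (T : X → X) (hT : Measurable T) (Δl : ℤ → Set X) (hΔl : ∀ l, MeasurableSet (Δl l))
    (hdisj : Pairwise (Function.onFun Disjoint Δl)) (hcover : lam (⋃ l, Δl l)ᶜ = 0) (d : ℝ)
    (h1 : ∀ ℓ : List ℤ, ∀ s, MeasurableSet s → lam.real (cylinder T Δl ℓ ∩ T^[ℓ.length] ⁻¹' s) ≤
      d * (lam.real (cylinder T Δl ℓ) * lam.real s))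
    (h2 : ∀ ℓ : List ℤ, ∀ s, MeasurableSet s → lam.real (cylinder T Δl ℓ) * lam.real s ≤
      d * lam.real (cylinder T Δl ℓ ∩ T^[ℓ.length] ⁻¹' s))
    (hpos : ∀ ℓ : List ℤ, 0 < lam.real (cylinder T Δl ℓ)) :
    ∃ μ : Measure X, IsProbabilityMeasure μ ∧ μ.map T = μ ∧ μ ≪ lam ∧
      ∃ K : ℝ≥0∞, 0 < K ∧ K < ⊤ ∧
        ∀ ℓ : List ℤ, ℓ ≠ [] → ∀ s : Set X, MeasurableSet s →
          K⁻¹ * μ s ≤ (μ (cylinder T Δl ℓ))⁻¹ *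
              ((μ.restrict (cylinder T Δl ℓ)).map (T^[ℓ.length])) s ∧
            (μ (cylinder T Δl ℓ))⁻¹ *
              ((μ.restrict (cylinder T Δl ℓ)).map (T^[ℓ.length])) s ≤ K * μ s := by
  have hnil : cylinder T Δl [] = Set.univ := by
    ext x; simp only [_root_.cylinder, Set.mem_ofPred_eq, Set.mem_univ, iff_true]
    intro k; exact k.elim0
  have hsing : ∀ l, cylinder T Δl [l] = Δl l := by
    intro l; ext x; simp [_root_.cylinder]
  have hd1 : 1 ≤ d := by
    have := h2 [] Set.univ .univ
    simpa [hnil] using this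
  have hd0 : 0 < d := by linarith
  have hcm := aux_cyl_meas hT hΔl
  have hq : Measure.QuasiMeasurePreserving T lam lam := by
    refine ⟨hT, Measure.AbsolutelyContinuous.mk fun s hs h0 => ?_⟩
    rw [Measure.map_apply hT hs]
    have hsub : T ⁻¹' s ⊆ (⋃ l, Δl l)ᶜ ∪ ⋃ l, (Δl l ∩ T ⁻¹' s) := by
      intro x hx
      by_cases hxl : x ∈ ⋃ l, Δl l
      · right
        obtain ⟨l, hl⟩ := Set.mem_iUnion.1 hxl
        exact Set.mem_iUnion.2 ⟨l, hl, hx⟩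
      · left; exact hxl
    refine measure_mono_null hsub (measure_union_null hcover (measure_iUnion_null fun l => ?_))
    have := h1 [l] s hs
    rw [hsing, measureReal_def (s := s), h0] at this
    simp only [ENNReal.toReal_zero, mul_zero, List.length_singleton, Function.iterate_one] at this
    have h3 := le_antisymm this measureReal_nonneg
    rwa [measureReal_eq_zero_iff] at h3
  have hae : ∀ᵐ x ∂lam, ∀ k : ℕ, T^[k] x ∈ ⋃ l, Δl l := by
    rw [ae_all_iff]
    intro k
    exact (hq.iterate k).ae (show ∀ᵐ x ∂lam, x ∈ ⋃ l, Δl l from hcover)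
  have hsum : ∀ (k : ℕ) (E : Set X), MeasurableSet E →
      HasSum (fun ℓ : {ℓ : List ℤ // ℓ.length = k} => lam.real (cylinder T Δl ℓ.1 ∩ E)) (lam.real E) := by
    intro k E hE
    have hdj : Pairwise (Function.onFun Disjoint
        fun ℓ : {ℓ : List ℤ // ℓ.length = k} => cylinder T Δl ℓ.1 ∩ E) := by
      rintro ⟨ℓ, hℓ⟩ ⟨ℓ', hℓ'⟩ hne
      refine Set.disjoint_left.2 fun x hx hx' => hne ?_
      refine Subtype.ext (List.ext_get (hℓ.trans hℓ'.symm) fun i hi hi' => ?_)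
      by_contra hcon
      exact Set.disjoint_left.1 (hdisj hcon) (hx.1 ⟨i, hi⟩) (hx'.1 ⟨i, hi'⟩)
    have hU : lam (⋃ ℓ : {ℓ : List ℤ // ℓ.length = k}, cylinder T Δl ℓ.1 ∩ E) = lam E := by
      refine measure_congr ?_
      filter_upwards [hae] with x hx
      refine propext ⟨fun h => ?_, fun h => ?_⟩
      · obtain ⟨ℓ, hℓ⟩ := Set.mem_iUnion.1 h
        exact hℓ.2
      · have hx' : ∀ k, ∃ l, T^[k] x ∈ Δl l := fun k => by simpa using hx k
        choose w hw using hx'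
        refine Set.mem_iUnion.2 ⟨⟨List.ofFn fun i : Fin k => w i, by simp⟩, ?_, h⟩
        intro i
        simpa using hw i
    have h := measure_iUnion (μ := lam) hdj (fun ℓ => (hcm ℓ.1).inter hE)
    rw [hU] at h
    have hne : ∑' ℓ : {ℓ : List ℤ // ℓ.length = k}, lam (cylinder T Δl ℓ.1 ∩ E) ≠ ⊤ := by
      rw [← h]; exact measure_ne_top _ _
    have := ENNReal.hasSum_toReal hne
    rwa [← ENNReal.tsum_toReal_eq (fun i => measure_ne_top _ _), ← h] at this
  have hsum1 : ∀ k, HasSum (fun ℓ : {ℓ : List ℤ // ℓ.length = k} => lam.real (cylinder T Δl ℓ.1)) 1 := by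
    intro k
    simpa using hsum k Set.univ .univ
  obtain ⟨μ, hμp, hμT, hμ⟩ := aux_exists_inv lam T hT d
    (fun k s hs => by
      have := hasSum_le (fun ℓ => ?_) (hsum k (T^[k] ⁻¹' s) (hT.iterate k hs))
        (((hsum1 k).mul_right (lam.real s)).mul_left d)
      · simpa using this
      · obtain ⟨ℓ, rfl⟩ := ℓ
        exact h1 ℓ s hs)
    (fun k s hs => by
      have := hasSum_le (fun ℓ => ?_) ((hsum1 k).mul_right (lam.real s))
        ((hsum k (T^[k] ⁻¹' s) (hT.iterate k hs)).mul_left d)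
      · simpa using this
      · obtain ⟨ℓ, rfl⟩ := ℓ
        exact h2 ℓ s hs)
  refine ⟨μ, hμp, hμT, Measure.AbsolutelyContinuous.mk fun s hs h0 => ?_,
    ENNReal.ofReal (d ^ 4), by simpa using by positivity, ENNReal.ofReal_lt_top, fun ℓ _ s hs => ?_⟩
  · have := (hμ s hs).1
    rw [measureReal_def (μ := lam), h0] at this
    simp only [ENNReal.toReal_zero, mul_zero] at this
    have h3 := le_antisymm this measureReal_nonneg
    rwa [measureReal_eq_zero_iff] at h3
  · rw [Measure.map_apply (hT.iterate _) hs, Measure.restrict_apply (hT.iterate _ hs), Set.inter_comm]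
    have hE : MeasurableSet (cylinder T Δl ℓ ∩ T^[ℓ.length] ⁻¹' s) := (hcm ℓ).inter (hT.iterate _ hs)
    have a1 := hμ _ hE
    have a2 := hμ _ (hcm ℓ)
    have a3 := hμ _ hs
    have b1 := h1 ℓ s hs
    have b2 := h2 ℓ s hs
    have hp := hpos ℓ
    rw [← ofReal_measureReal (μ := μ) (s := cylinder T Δl ℓ), ← ofReal_measureReal (μ := μ) (s := s),
      ← ofReal_measureReal (μ := μ) (s := cylinder T Δl ℓ ∩ T^[ℓ.length] ⁻¹' s)]
    have n1 := measureReal_nonneg (μ := lam) (s := s)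
    have n2 := measureReal_nonneg (μ := μ) (s := s)
    generalize lam.real (cylinder T Δl ℓ ∩ T^[ℓ.length] ⁻¹' s) = e at *
    generalize μ.real (cylinder T Δl ℓ ∩ T^[ℓ.length] ⁻¹' s) = e' at *
    generalize lam.real (cylinder T Δl ℓ) = c at *
    generalize μ.real (cylinder T Δl ℓ) = c' at *
    generalize lam.real s = t at *
    generalize μ.real s = t' at *
    have hc' : 0 < c' := by
      by_contra hcon
      nlinarith [a2.2]
    have m1 : c * t ≤ (d * c') * (d * t') := mul_le_mul a2.2 a3.2 n1 (by positivity)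
    have m2 : c' * t' ≤ (d * c) * (d * t) := mul_le_mul a2.1 a3.1 n2 (by positivity)
    have r1 : e' ≤ d ^ 4 * (c' * t') := by
      calc e' ≤ d * e := a1.1
        _ ≤ d * (d * (c * t)) := by gcongr
        _ ≤ d * (d * ((d * c') * (d * t'))) := by gcongr
        _ = _ := by ring
    have r2 : c' * t' ≤ d ^ 4 * e' := by
      calc c' * t' ≤ (d * c) * (d * t) := m2
        _ = d ^ 2 * (c * t) := by ring
        _ ≤ d ^ 2 * (d * (d * e')) := by
          refine mul_le_mul_of_nonneg_left (b2.trans ?_) (by positivity)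
          exact mul_le_mul_of_nonneg_left a1.2 hd0.le
        _ = _ := by ring
    have hd4 : 0 < d ^ 4 := by positivity
    rw [← ENNReal.ofReal_inv_of_pos hc', ← ENNReal.ofReal_inv_of_pos hd4,
      ← ENNReal.ofReal_mul (by positivity), ← ENNReal.ofReal_mul (by positivity),
      ← ENNReal.ofReal_mul (by positivity)]
    constructor
    · refine ENNReal.ofReal_le_ofReal ?_
      rw [inv_mul_le_iff₀ hd4, mul_left_comm, le_inv_mul_iff₀ hc']
      exact r2
    · refine ENNReal.ofReal_le_ofReal ?_
      rw [inv_mul_le_iff₀ hc']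
      linarith
/-- section of the projection from the affine hyperplane. -/
def auxSec {n : ℕ} (y : Fin n → ℝ) : Fin (n + 1) → ℝ := Fin.cons (1 - ∑ i, y i) y

/-- truncated cone over a set -/
def auxCone {p : ℕ} (A : Set (Fin p → ℝ)) : Set (Fin p → ℝ) :=
  {z | ∃ t ∈ Set.Ioc (0 : ℝ) 1, ∃ x ∈ A, z = t • x}

/-- straightening linear map -/
def auxL (n : ℕ) : (Fin (n + 1) → ℝ) →ₗ[ℝ] (Fin (n + 1) → ℝ) where
  toFun w := Fin.cons (w 0 - ∑ i : Fin n, w i.succ) (fun i : Fin n => w i.succ)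
  map_add' v w := by
    funext i
    refine Fin.cases ?_ (fun i => ?_) i
    · simp [Finset.sum_add_distrib]; ring
    · simp
  map_smul' c w := by
    funext i
    refine Fin.cases ?_ (fun i => ?_) i
    · simp [← Finset.mul_sum]; ring
    · simp

lemma auxL_det (n : ℕ) : LinearMap.det (auxL n) ≠ 0 := by
  have hinj : Function.Injective (auxL n) := by
    rw [← LinearMap.ker_eq_bot, LinearMap.ker_eq_bot']
    intro w hw
    have hs : ∀ i : Fin n, w i.succ = 0 := fun i => by
      have := congrFun hw i.succ
      simpa [auxL] using this
    have h0 : w 0 = 0 := by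
      have := congrFun hw 0
      simpa [auxL, hs] using this
    funext i
    exact Fin.cases h0 hs i
  have := (LinearEquiv.ofInjectiveEndo (auxL n) hinj).isUnit_det'
  exact this.ne_zero

lemma auxSec_meas {n : ℕ} : Measurable (auxSec (n := n)) := by
  refine measurable_pi_lambda _ fun i => ?_
  refine Fin.cases ?_ (fun i => ?_) i
  · simp only [auxSec, Fin.cons_zero]; fun_prop
  · simp only [auxSec, Fin.cons_succ]; fun_prop

lemma auxSec_tail {n : ℕ} (x : Fin (n + 1) → ℝ) (hx : ∑ i, x i = 1) :
    auxSec (fun i : Fin n => x i.succ) = x := by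
  rw [Fin.sum_univ_succ] at hx
  funext i
  refine Fin.cases ?_ (fun i => ?_) i
  · simp only [auxSec, Fin.cons_zero]; linarith
  · simp [auxSec]

lemma auxCone_eq {n : ℕ} (A : Set (Fin (n + 1) → ℝ)) (hA : ∀ x ∈ A, ∑ i, x i = 1) :
    auxCone A = auxL n '' ((MeasurableEquiv.piFinSuccAbove (fun _ : Fin (n + 1) => ℝ) 0) ⁻¹'
      {q : ℝ × (Fin n → ℝ) | q.1 ∈ Set.Ioc (0 : ℝ) 1 ∧ q.1⁻¹ • q.2 ∈ auxSec ⁻¹' A}) := by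
  have key : ∀ (t : ℝ) (y : Fin n → ℝ), auxL n (Fin.cons t (t • y)) = t • auxSec y := by
    intro t y
    funext i
    refine Fin.cases ?_ (fun i => ?_) i
    · simp [auxL, auxSec, ← Finset.mul_sum]; ring
    · simp [auxL, auxSec]
  ext z
  constructor
  · rintro ⟨t, ht, x, hx, rfl⟩
    refine ⟨Fin.cons t (t • fun i : Fin n => x i.succ), ?_, ?_⟩
    · have e : (t⁻¹ • t • fun i : Fin n => x i.succ) = fun i : Fin n => x i.succ :=
        inv_smul_smul₀ ht.1.ne' _
      simp only [Set.mem_preimage, Set.mem_ofPred_eq, MeasurableEquiv.piFinSuccAbove,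
        MeasurableEquiv.coe_mk, Fin.insertNthEquiv, Equiv.coe_fn_symm_mk]
      simp only [Fin.cons_zero, Fin.removeNth_zero, Fin.tail_cons]
      exact ⟨ht, by rw [e, auxSec_tail x (hA x hx)]; exact hx⟩
    · rw [key, auxSec_tail x (hA x hx)]
  · rintro ⟨w, hw, rfl⟩
    simp only [Set.mem_preimage, Set.mem_ofPred_eq, MeasurableEquiv.piFinSuccAbove,
        MeasurableEquiv.coe_mk, Fin.insertNthEquiv, Equiv.coe_fn_symm_mk, Fin.removeNth_zero] at hw
    obtain ⟨ht, hy⟩ := hw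
    refine ⟨w 0, ht, _, hy, ?_⟩
    rw [← key, smul_inv_smul₀ ht.1.ne', Fin.cons_self_tail]

/-- cone volume constant -/
noncomputable def auxC (n : ℕ) : ℝ≥0∞ := ENNReal.ofReal |LinearMap.det (auxL n)| *
  ∫⁻ t in Set.Ioc (0 : ℝ) 1, ENNReal.ofReal (t ^ n)

lemma auxC_pos (n : ℕ) : auxC n ≠ 0 := by
  refine mul_ne_zero ?_ ?_
  · simpa using auxL_det n
  · refine ne_of_gt ?_
    rw [setLIntegral_pos_iff (by fun_prop)]
    have : Function.support (fun t : ℝ => ENNReal.ofReal (t ^ n)) ∩ Set.Ioc (0 : ℝ) 1 = Set.Ioc (0 : ℝ) 1 := by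
      refine Set.inter_eq_right.2 fun t ht => ?_
      have : 0 < t ^ n := pow_pos ht.1 n
      simpa using this
    rw [this]; simp

lemma auxC_top (n : ℕ) : auxC n ≠ ⊤ := by
  refine ENNReal.mul_ne_top ENNReal.ofReal_ne_top ?_
  refine ne_top_of_le_ne_top (b := ∫⁻ t in Set.Ioc (0 : ℝ) 1, 1) (by simp) ?_
  refine setLIntegral_mono measurable_const fun t ht => ?_
  rw [ENNReal.ofReal_le_one]
  exact pow_le_one₀ ht.1.le ht.2

lemma auxCone_vol {n : ℕ} (A : Set (Fin (n + 1) → ℝ)) (hA : ∀ x ∈ A, ∑ i, x i = 1)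
    (hm : MeasurableSet A) : volume (auxCone A) = auxC n * volume (auxSec ⁻¹' A) := by
  have hm' := auxSec_meas hm
  have hS : MeasurableSet {q : ℝ × (Fin n → ℝ) | q.1 ∈ Set.Ioc (0 : ℝ) 1 ∧ q.1⁻¹ • q.2 ∈ auxSec ⁻¹' A} := by
    refine MeasurableSet.inter (measurable_fst measurableSet_Ioc) ?_
    have : Measurable fun q : ℝ × (Fin n → ℝ) => q.1⁻¹ • q.2 := by fun_prop
    exact this hm'
  rw [auxCone_eq A hA, Measure.addHaar_image_linearMap, auxC, mul_assoc]
  congr 1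
  rw [(volume_preserving_piFinSuccAbove (fun _ : Fin (n + 1) => ℝ) 0).measure_preimage
    hS.nullMeasurableSet, Measure.volume_eq_prod, Measure.prod_apply hS,
    ← lintegral_mul_const _ (by fun_prop), ← lintegral_indicator measurableSet_Ioc]
  refine lintegral_congr fun t => ?_
  by_cases ht : t ∈ Set.Ioc (0 : ℝ) 1
  · rw [Set.indicator_of_mem ht]
    have e : Prod.mk t ⁻¹' {q : ℝ × (Fin n → ℝ) | q.1 ∈ Set.Ioc (0 : ℝ) 1 ∧ q.1⁻¹ • q.2 ∈ auxSec ⁻¹' A}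
        = (t⁻¹ • ·) ⁻¹' (auxSec ⁻¹' A) := by
      ext y; simp only [Set.mem_preimage, Set.mem_ofPred_eq, ht, true_and]
    rw [e, Measure.addHaar_preimage_smul _ (inv_ne_zero ht.1.ne')]
    simp only [Module.finrank_fin_fun, inv_pow, inv_inv]
    rw [abs_of_nonneg (pow_nonneg ht.1.le n)]
  · rw [Set.indicator_of_notMem ht]
    have e : Prod.mk t ⁻¹' {q : ℝ × (Fin n → ℝ) | q.1 ∈ Set.Ioc (0 : ℝ) 1 ∧ q.1⁻¹ • q.2 ∈ auxSec ⁻¹' A} = ∅ := by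
      ext y; simp only [Set.mem_preimage, Set.mem_ofPred_eq, ht, false_and, Set.mem_empty_iff_false]
    rw [e]; simp

lemma aux_haus_lower {n : ℕ} (A : Set (Fin (n + 1) → ℝ)) :
    volume (auxSec ⁻¹' A) ≤ μH[(n : ℝ)] A := by
  have hl : LipschitzWith 1 (fun x : Fin (n + 1) → ℝ => fun i : Fin n => x i.succ) := by
    refine LipschitzWith.of_dist_le_mul fun x y => ?_
    rw [NNReal.coe_one, one_mul, dist_pi_le_iff dist_nonneg]
    exact fun i => dist_le_pi_dist x y i.succ
  have h1 := (hl.lipschitzOnWith (s := A)).hausdorffMeasure_image_le (d := (n : ℝ)) (Nat.cast_nonneg n)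
  have hv : (μH[(n : ℝ)] : Measure (Fin n → ℝ)) = volume := by
    have := hausdorffMeasure_pi_real (ι := Fin n)
    simpa using this
  rw [hv] at h1
  simp only [ENNReal.coe_one, ENNReal.one_rpow, one_mul] at h1
  refine le_trans (measure_mono ?_) h1
  intro y hy
  exact ⟨_, hy, by funext i; simp [auxSec]⟩

lemma aux_haus_upper {n : ℕ} (A : Set (Fin (n + 1) → ℝ)) (hA : ∀ x ∈ A, ∑ i, x i = 1) :
    μH[(n : ℝ)] A ≤ (((n + 1 : NNReal) : ℝ≥0∞) ^ (n : ℝ)) * volume (auxSec ⁻¹' A) := by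
  have hl : LipschitzWith (n + 1 : NNReal) (auxSec (n := n)) := by
    refine LipschitzWith.of_dist_le_mul fun x y => ?_
    have hd := dist_nonneg (x := x) (y := y)
    rw [dist_pi_le_iff (by positivity)]
    intro i
    push_cast
    refine Fin.cases ?_ (fun i => ?_) i
    · simp only [auxSec, Fin.cons_zero]
      rw [dist_sub_left]
      refine (dist_sum_sum_le_of_le Finset.univ fun i _ => dist_le_pi_dist x y i).trans ?_
      simp only [Finset.sum_const, Finset.card_univ, Fintype.card_fin, nsmul_eq_mul]
      nlinarith
    · simp only [auxSec, Fin.cons_succ]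
      have := dist_le_pi_dist x y i
      have hn : (0 : ℝ) ≤ n := Nat.cast_nonneg n
      nlinarith
  have h1 := (hl.lipschitzOnWith (s := auxSec ⁻¹' A)).hausdorffMeasure_image_le (d := (n : ℝ)) (Nat.cast_nonneg n)
  have hv : (μH[(n : ℝ)] : Measure (Fin n → ℝ)) = volume := by
    have := hausdorffMeasure_pi_real (ι := Fin n)
    simpa using this
  rw [hv] at h1
  refine le_trans (measure_mono ?_) h1
  intro x hx
  exact ⟨fun i => x i.succ, by simpa [auxSec_tail x (hA x hx)] using hx, auxSec_tail x (hA x hx)⟩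
lemma aux_sum_mulVec {p : ℕ} (B : Matrix (Fin p) (Fin p) ℝ) (x : Fin p → ℝ) :
    ∑ i, B.mulVec x i = ∑ j, (∑ i, B i j) * x j := by
  simp only [Matrix.mulVec, dotProduct]
  rw [Finset.sum_comm]
  simp [Finset.sum_mul]

lemma aux_S_pos {p : ℕ} (hp : 0 < p) (B : Matrix (Fin p) (Fin p) ℝ) (hB : IsUnit B)
    (h0 : ∀ i j, 0 ≤ B i j) : 0 < ∑ j, ∑ i, B i j := by
  have hnn : 0 ≤ ∑ j, ∑ i, B i j := Finset.sum_nonneg fun j _ => Finset.sum_nonneg fun i _ => h0 i j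
  refine lt_of_le_of_ne hnn fun h => ?_
  have hz : B = 0 := by
    ext i j
    have h1 := (Finset.sum_eq_zero_iff_of_nonneg (fun j _ => Finset.sum_nonneg fun i _ => h0 i j)).1 h.symm
      j (Finset.mem_univ j)
    exact (Finset.sum_eq_zero_iff_of_nonneg (fun i _ => h0 i j)).1 h1 i (Finset.mem_univ i)
  have : Nonempty (Fin p) := ⟨⟨0, hp⟩⟩
  rw [hz] at hB
  exact not_isUnit_zero hB

lemma aux_sum_bounds {p : ℕ} (B : Matrix (Fin p) (Fin p) ℝ) (h0 : ∀ i j, 0 ≤ B i j) (c : ℝ)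
    (x : Fin p → ℝ) (hx1 : ∀ i, c ≤ x i) (hx2 : ∀ i, x i ≤ 1) :
    c * (∑ j, ∑ i, B i j) ≤ ∑ i, B.mulVec x i ∧ ∑ i, B.mulVec x i ≤ ∑ j, ∑ i, B i j := by
  rw [aux_sum_mulVec, Finset.mul_sum]
  have hj : ∀ j, 0 ≤ ∑ i, B i j := fun j => Finset.sum_nonneg fun i _ => h0 i j
  constructor
  · refine Finset.sum_le_sum fun j _ => ?_
    rw [mul_comm]; exact mul_le_mul_of_nonneg_left (hx1 j) (hj j)
  · exact Finset.sum_le_sum fun j _ => mul_le_of_le_one_right (hj j) (hx2 j)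

open Pointwise in
lemma aux_cone_distort {p : ℕ} (hp : 0 < p) (B : Matrix (Fin p) (Fin p) ℝ) (hB : IsUnit B)
    (h0 : ∀ i j, 0 ≤ B i j) (c : ℝ) (hc : 0 < c) (A : Set (Fin p → ℝ))
    (hx1 : ∀ x ∈ A, ∀ i, c ≤ x i) (hx2 : ∀ x ∈ A, ∀ i, x i ≤ 1) :
    ENNReal.ofReal ((c * ∑ j, ∑ i, B i j) ^ p) * volume (auxCone (projNormalize B '' A)) ≤
      ENNReal.ofReal |B.det| * volume (auxCone A) ∧
    ENNReal.ofReal |B.det| * volume (auxCone A) ≤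
      ENNReal.ofReal ((∑ j, ∑ i, B i j) ^ p) * volume (auxCone (projNormalize B '' A)) := by
  have hS := aux_S_pos hp B hB h0
  have hbd := fun x (hx : x ∈ A) => aux_sum_bounds B h0 c x (hx1 x hx) (hx2 x hx)
  set S := ∑ j, ∑ i, B i j with hSdef
  have himg : ENNReal.ofReal |B.det| * volume (auxCone A) = volume (Matrix.toLin' B '' auxCone A) := by
    rw [Measure.addHaar_image_linearMap, LinearMap.det_toLin']
  have hcS : 0 < c * S := mul_pos hc hS
  have hsm : ∀ (r : ℝ) (_ : 0 ≤ r) (E : Set (Fin p → ℝ)), ENNReal.ofReal (r ^ p) * volume E = volume (r • E) := by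
    intro r hr E
    rw [Measure.addHaar_smul_of_nonneg _ hr]; simp
  rw [himg, hsm _ hcS.le, hsm _ hS.le]
  constructor
  · refine measure_mono ?_
    rintro _ ⟨_, ⟨t, ht, _, ⟨x, hx, rfl⟩, rfl⟩, rfl⟩
    have hb := hbd x hx
    have hpos : 0 < ∑ i, B.mulVec x i := hcS.trans_le hb.1
    refine ⟨((c * S) * t * (∑ i, B.mulVec x i)⁻¹) • x, ⟨_, ⟨?_, ?_⟩, x, hx, rfl⟩, ?_⟩
    · have := ht.1; positivity
    · rw [← div_eq_mul_inv, div_le_one hpos]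
      exact (mul_le_of_le_one_right hcS.le ht.2).trans hb.1
    · simp only [map_smul, Matrix.toLin'_apply, projNormalize, smul_smul, mul_assoc]
  · refine measure_mono ?_
    rintro _ ⟨_, ⟨t, ht, x, hx, rfl⟩, rfl⟩
    have hb := hbd x hx
    have hpos : 0 < ∑ i, B.mulVec x i := hcS.trans_le hb.1
    refine ⟨(t * (∑ i, B.mulVec x i) / S) • projNormalize B x, ⟨_, ⟨?_, ?_⟩, _, ⟨x, hx, rfl⟩, rfl⟩, ?_⟩
    · have := ht.1; positivity
    · rw [div_le_one hS]
      exact (mul_le_of_le_one_left hpos.le ht.2).trans hb.2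
    · simp only [map_smul, Matrix.toLin'_apply, projNormalize, smul_smul]
      congr 1
      field_simp

lemma aux_proj_comp {p : ℕ} (A B : Matrix (Fin p) (Fin p) ℝ) (x : Fin p → ℝ)
    (h : ∑ i, B.mulVec x i ≠ 0) :
    projNormalize A (projNormalize B x) = projNormalize (A * B) x := by
  simp only [projNormalize, Matrix.mulVec_smul, Matrix.mulVec_mulVec, Pi.smul_apply, smul_eq_mul,
    ← Finset.mul_sum, smul_smul]
  congr 1
  rw [mul_inv, inv_inv, mul_right_comm, mul_inv_cancel₀ h, one_mul]

lemma aux_word {p : ℕ} (hp : 0 < p) (Δ : Set (Fin p → ℝ)) (hΔ : Δ ⊆ openStdSimplex p)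
    (Δl : ℤ → Set (Fin p → ℝ)) (hΔlsub : ∀ l, Δl l ⊆ Δ)
    (T : (Fin p → ℝ) → (Fin p → ℝ)) (hTbij : ∀ l, Set.BijOn T (Δl l) Δ)
    (hTbranch : ∀ l, ∃ B : Matrix (Fin p) (Fin p) ℝ, IsUnit B ∧ (∀ i j, 0 ≤ B i j) ∧
      ∀ y ∈ Δ, projNormalize B y ∈ Δl l ∧ T (projNormalize B y) = y) (ℓ : List ℤ) :
    ∃ B : Matrix (Fin p) (Fin p) ℝ, IsUnit B ∧ (∀ i j, 0 ≤ B i j) ∧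
      ∀ s, (cylinder T Δl ℓ ∩ T^[ℓ.length] ⁻¹' s) ∩ Δ = projNormalize B '' (s ∩ Δ) := by
  induction ℓ with
  | nil =>
    refine ⟨1, isUnit_one, fun i j => ?_, fun s => ?_⟩
    · rw [Matrix.one_apply]; split_ifs <;> norm_num
    · have hid : ∀ x ∈ Δ, projNormalize 1 x = x := fun x hx => by
        simp [projNormalize, (hΔ hx).2]
      ext x
      constructor
      · rintro ⟨⟨-, hs⟩, hx⟩
        exact ⟨x, ⟨hs, hx⟩, hid x hx⟩
      · rintro ⟨y, ⟨hs, hy⟩, rfl⟩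
        rw [hid y hy]
        exact ⟨⟨fun k => k.elim0, hs⟩, hy⟩
  | cons a ℓ ih =>
    obtain ⟨B, hB, hB0, hBs⟩ := ih
    obtain ⟨A, hA, hA0, hAs⟩ := hTbranch a
    refine ⟨A * B, hA.mul hB, fun i j => ?_, fun s => ?_⟩
    · rw [Matrix.mul_apply]
      exact Finset.sum_nonneg fun k _ => mul_nonneg (hA0 _ _) (hB0 _ _)
    have hcyl : ∀ x, x ∈ cylinder T Δl (a :: ℓ) ↔ x ∈ Δl a ∧ T x ∈ cylinder T Δl ℓ := by
      intro x
      constructor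
      · intro h
        refine ⟨h ⟨0, by simp⟩, fun k => ?_⟩
        have := h ⟨k + 1, by simp⟩
        simpa using this
      · rintro ⟨h1, h2⟩ k
        obtain ⟨k, hk⟩ := k
        cases k with
        | zero => simpa using h1
        | succ k =>
          have := h2 ⟨k, by simpa using hk⟩
          simpa using this
    have hcomp : ∀ y ∈ Δ, projNormalize (A * B) y = projNormalize A (projNormalize B y) := fun y hy => by
      refine (aux_proj_comp A B y ?_).symm
      have hS := aux_S_pos hp B hB hB0
      have hy1 := (hΔ hy).1
      rw [aux_sum_mulVec]
      intro h
      have hj : ∀ j, 0 ≤ ∑ i, B i j := fun j => Finset.sum_nonneg fun i _ => hB0 i j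
      have h1 := (Finset.sum_eq_zero_iff_of_nonneg (fun j _ => mul_nonneg (hj j) (hy1 j).le)).1 h
      refine hS.ne' (Finset.sum_eq_zero fun j hj => ?_)
      exact (mul_eq_zero.1 (h1 j hj)).resolve_right (hy1 j).ne'
    have hBs' : ∀ y ∈ s ∩ Δ, projNormalize B y ∈ (cylinder T Δl ℓ ∩ T^[ℓ.length] ⁻¹' s) ∩ Δ := fun y hy => by
      rw [hBs s]; exact ⟨y, hy, rfl⟩
    ext x
    constructor
    · rintro ⟨⟨hx1, hx2⟩, -⟩
      obtain ⟨hxa, hxT⟩ := (hcyl x).1 hx1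
      have hmem : T x ∈ (cylinder T Δl ℓ ∩ T^[ℓ.length] ⁻¹' s) ∩ Δ :=
        ⟨⟨hxT, by simpa using hx2⟩, (hTbij a).mapsTo hxa⟩
      rw [hBs s] at hmem
      obtain ⟨y, hy, hyx⟩ := hmem
      refine ⟨y, hy, ?_⟩
      rw [hcomp y hy.2, hyx]
      have hTx := (hTbij a).mapsTo hxa
      exact (hTbij a).injOn (hAs _ hTx).1 hxa (hAs _ hTx).2
    · rintro ⟨y, hy, rfl⟩
      rw [hcomp y hy.2]
      have h := hBs' y hy
      obtain ⟨k1, k2⟩ := hAs _ h.2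
      refine ⟨⟨(hcyl _).2 ⟨k1, by rw [k2]; exact h.1.1⟩, ?_⟩, hΔlsub a k1⟩
      simp only [List.length_cons, Set.mem_preimage, Function.iterate_succ, Function.comp_apply, k2]
      exact h.1.2
/-- Under the hypotheses of the previous statement, the invariant absolutely continuous
probability measure `μ` can be chosen so that `T` is strongly expanding: there is `K > 0`
such that for every nonempty finite word `ℓ`, the normalized push-forward
`μ^ℓ = μ(Δ^ℓ)⁻¹ (T^ℓ)_* μ` has density with respect to `μ` between `K⁻¹` and `K`. -/
theorem exists_invariant_acip_stronglyExpanding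
    {p : ℕ} (hp : 2 ≤ p)
    (Δ : Set (Fin p → ℝ)) (hΔmeas : MeasurableSet Δ)
    (hΔcc : closure Δ ⊆ openStdSimplex p)
    (C : Matrix (Fin p) (Fin p) ℝ) (hCinv : IsUnit C) (hCnonneg : ∀ i j, 0 ≤ C i j)
    (hΔsimplex : Δ = projNormalize C '' openStdSimplex p)
    (leb : Measure (Fin p → ℝ)) (hleb : leb = (μH[(p : ℝ) - 1]).restrict Δ)
    (Δl : ℤ → Set (Fin p → ℝ)) (hΔlmeas : ∀ l, MeasurableSet (Δl l))
    (hΔlsub : ∀ l, Δl l ⊆ Δ) (hΔlpos : ∀ l, 0 < leb (Δl l))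
    (hΔldisj : Pairwise (Function.onFun Disjoint Δl))
    (hΔlcover : leb (Δ \ ⋃ l, Δl l) = 0)
    (T : (Fin p → ℝ) → (Fin p → ℝ)) (hTmeas : Measurable T)
    (hTbij : ∀ l, Set.BijOn T (Δl l) Δ)
    (hTbranch : ∀ l, ∃ B : Matrix (Fin p) (Fin p) ℝ, IsUnit B ∧ (∀ i j, 0 ≤ B i j) ∧
      ∀ y ∈ Δ, projNormalize B y ∈ Δl l ∧ T (projNormalize B y) = y) :
    ∃ μ : Measure (Fin p → ℝ), IsProbabilityMeasure μ ∧ μ.map T = μ ∧ μ ≪ leb ∧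
      ∃ K : ℝ≥0∞, 0 < K ∧ K < ⊤ ∧
        ∀ ℓ : List ℤ, ℓ ≠ [] → ∀ s : Set (Fin p → ℝ), MeasurableSet s →
          K⁻¹ * μ s ≤ (μ (cylinder T Δl ℓ))⁻¹ *
              ((μ.restrict (cylinder T Δl ℓ)).map (T^[ℓ.length])) s ∧
            (μ (cylinder T Δl ℓ))⁻¹ *
              ((μ.restrict (cylinder T Δl ℓ)).map (T^[ℓ.length])) s ≤ K * μ s := by
  obtain ⟨n, rfl⟩ : ∃ n, p = n + 1 := ⟨p - 1, by omega⟩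
  have hpp : 0 < n + 1 := Nat.succ_pos n
  have hleb' : leb = (μH[(n : ℝ)]).restrict Δ := by
    rw [hleb]; congr 2; push_cast; ring
  clear hleb hΔsimplex
  have hΔ : Δ ⊆ openStdSimplex (n + 1) := subset_closure.trans hΔcc
  have hle1 : ∀ x ∈ openStdSimplex (n + 1), ∀ i, x i ≤ 1 := fun x hx i => by
    rw [← hx.2]
    exact Finset.single_le_sum (fun j _ => (hx.1 j).le) (Finset.mem_univ i)
  -- lower bound on coordinates
  obtain ⟨c, hc, hcx⟩ : ∃ c : ℝ, 0 < c ∧ ∀ x ∈ Δ, ∀ i, c ≤ x i := by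
    have hb : Bornology.IsBounded (closure Δ) := by
      refine (Metric.isBounded_Icc (0 : Fin (n + 1) → ℝ) 1).subset fun x hx => ?_
      exact ⟨fun i => ((hΔcc hx).1 i).le, fun i => hle1 x (hΔcc hx) i⟩
    have hK : IsCompact (closure Δ) := Metric.isCompact_of_isClosed_isBounded isClosed_closure hb
    have := fun i => hK.exists_forall_le' (f := fun x => x i) (continuous_apply i).continuousOn
      (a := (0 : ℝ)) (fun x hx => (hΔcc hx).1 i)
    choose e he hex using this
    obtain ⟨i0, -, hi0⟩ := Finset.exists_min_image Finset.univ e ⟨0, Finset.mem_univ _⟩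
    exact ⟨e i0, he i0, fun x hx i => (hi0 i (Finset.mem_univ i)).trans (hex i x (subset_closure hx))⟩
  -- finiteness of the cone volume
  have hvfin : ∀ A ⊆ Δ, volume (auxCone A) ≠ ⊤ := fun A hA => by
    refine ne_top_of_le_ne_top (b := volume (Set.Icc (0 : Fin (n + 1) → ℝ) 1)) ?_ (measure_mono ?_)
    · exact (isCompact_Icc.measure_lt_top).ne
    · rintro _ ⟨t, ht, x, hx, rfl⟩
      have hx' := hΔ (hA hx)
      constructor
      · intro i; exact mul_nonneg ht.1.le (hx'.1 i).le
      · intro i; exact mul_le_one₀ ht.2 (hx'.1 i).le (hle1 x hx' i)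
  have hsum1 : ∀ A ⊆ Δ, ∀ x ∈ A, ∑ i, x i = 1 := fun A hA x hx => (hΔ (hA hx)).2
  set N : ℝ≥0∞ := (((n + 1 : NNReal) : ℝ≥0∞) ^ (n : ℝ)) with hN
  have hNtop : N ≠ ⊤ := ENNReal.rpow_ne_top_of_nonneg (Nat.cast_nonneg n) ENNReal.coe_ne_top
  have hsecfin : ∀ A ⊆ Δ, MeasurableSet A → volume (auxSec ⁻¹' A) ≠ ⊤ := fun A hA hm h => by
    have h1 := auxCone_vol A (hsum1 A hA) hm
    rw [h, ENNReal.mul_top (auxC_pos n)] at h1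
    exact hvfin A hA h1
  have hHfin : ∀ A ⊆ Δ, MeasurableSet A → (μH[(n : ℝ)] : Measure (Fin (n + 1) → ℝ)) A ≠ ⊤ := fun A hA hm =>
    ne_top_of_le_ne_top (ENNReal.mul_ne_top hNtop (hsecfin A hA hm)) (aux_haus_upper A (hsum1 A hA))
  -- real-valued comparison
  set h : Set (Fin (n + 1) → ℝ) → ℝ := fun A => ((μH[(n : ℝ)] : Measure (Fin (n + 1) → ℝ)) A).toReal with hh
  set v : Set (Fin (n + 1) → ℝ) → ℝ := fun A => (volume (auxCone A)).toReal with hv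
  set c0 : ℝ := (auxC n).toReal with hc0
  set M : ℝ := N.toReal with hM
  have hc0pos : 0 < c0 := ENNReal.toReal_pos (auxC_pos n) (auxC_top n)
  have hM0 : 0 ≤ M := ENNReal.toReal_nonneg
  have hh0 : ∀ A, 0 ≤ h A := fun A => ENNReal.toReal_nonneg
  have hv0 : ∀ A, 0 ≤ v A := fun A => ENNReal.toReal_nonneg
  have hvh : ∀ A ⊆ Δ, MeasurableSet A → v A ≤ c0 * h A := fun A hA hm => by
    have h1 : volume (auxCone A) ≤ auxC n * (μH[(n : ℝ)] : Measure (Fin (n + 1) → ℝ)) A := by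
      rw [auxCone_vol A (hsum1 A hA) hm]
      exact mul_le_mul_right (aux_haus_lower A) _
    have h2 := ENNReal.toReal_mono (ENNReal.mul_ne_top (auxC_top n) (hHfin A hA hm)) h1
    rwa [ENNReal.toReal_mul] at h2
  have hhv : ∀ A ⊆ Δ, MeasurableSet A → c0 * h A ≤ M * v A := fun A hA hm => by
    have h1 : auxC n * (μH[(n : ℝ)] : Measure (Fin (n + 1) → ℝ)) A ≤ N * volume (auxCone A) := by
      rw [auxCone_vol A (hsum1 A hA) hm, mul_left_comm]
      exact mul_le_mul_right (aux_haus_upper A (hsum1 A hA)) _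
    have h2 := ENNReal.toReal_mono (ENNReal.mul_ne_top hNtop (hvfin A hA)) h1
    rwa [ENNReal.toReal_mul, ENNReal.toReal_mul] at h2
  -- distortion
  have hEmeas : ∀ (ℓ : List ℤ) s, MeasurableSet s →
      MeasurableSet ((cylinder T Δl ℓ ∩ T^[ℓ.length] ⁻¹' s) ∩ Δ) := fun ℓ s hs =>
    ((aux_cyl_meas hTmeas hΔlmeas ℓ).inter (hTmeas.iterate _ hs)).inter hΔmeas
  set D : ℝ := M ^ 2 * (c ^ (n + 1))⁻¹ with hD
  have hword : ∀ ℓ : List ℤ, ∃ k δ : ℝ, 0 < k ∧ 0 < δ ∧ ∀ s, MeasurableSet s →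
      c ^ (n + 1) * k * v ((cylinder T Δl ℓ ∩ T^[ℓ.length] ⁻¹' s) ∩ Δ) ≤ δ * v (s ∩ Δ) ∧
      δ * v (s ∩ Δ) ≤ k * v ((cylinder T Δl ℓ ∩ T^[ℓ.length] ⁻¹' s) ∩ Δ) := by
    intro ℓ
    obtain ⟨B, hB, hB0, hBs⟩ := aux_word hpp Δ hΔ Δl hΔlsub T hTbij hTbranch ℓ
    have hS := aux_S_pos hpp B hB hB0
    have hdet : B.det ≠ 0 := ((Matrix.isUnit_iff_isUnit_det B).1 hB).ne_zero
    refine ⟨(∑ j, ∑ i, B i j) ^ (n + 1), |B.det|, by positivity, by positivity, fun s hs => ?_⟩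
    have key := aux_cone_distort hpp B hB hB0 c hc (s ∩ Δ) (fun x hx => hcx x hx.2)
      (fun x hx => hle1 x (hΔ hx.2))
    rw [← hBs s] at key
    have f1 := hvfin (s ∩ Δ) Set.inter_subset_right
    have f2 := hvfin ((cylinder T Δl ℓ ∩ T^[ℓ.length] ⁻¹' s) ∩ Δ) Set.inter_subset_right
    have k1 := ENNReal.toReal_mono (ENNReal.mul_ne_top ENNReal.ofReal_ne_top f1) key.1
    have k2 := ENNReal.toReal_mono (ENNReal.mul_ne_top ENNReal.ofReal_ne_top f2) key.2
    rw [ENNReal.toReal_mul, ENNReal.toReal_mul, ENNReal.toReal_ofReal (by positivity),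
      ENNReal.toReal_ofReal (by positivity)] at k1 k2
    rw [mul_pow] at k1
    exact ⟨k1, k2⟩
  have hdist : ∀ ℓ : List ℤ, ∀ s t, MeasurableSet s → MeasurableSet t →
      h ((cylinder T Δl ℓ ∩ T^[ℓ.length] ⁻¹' s) ∩ Δ) * h (t ∩ Δ) ≤
      D * (h ((cylinder T Δl ℓ ∩ T^[ℓ.length] ⁻¹' t) ∩ Δ) * h (s ∩ Δ)) := by
    intro ℓ s t hs ht
    obtain ⟨k, δ, hk, hδ, hkd⟩ := hword ℓ
    have p1 := (hkd s hs).1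
    have p2 := (hkd t ht).2
    have q1 := hhv _ Set.inter_subset_right (hEmeas ℓ s hs)
    have q2 := hhv (t ∩ Δ) Set.inter_subset_right (ht.inter hΔmeas)
    have q3 := hvh _ Set.inter_subset_right (hEmeas ℓ t ht)
    have q4 := hvh (s ∩ Δ) Set.inter_subset_right (hs.inter hΔmeas)
    have z1 := hh0 ((cylinder T Δl ℓ ∩ T^[ℓ.length] ⁻¹' s) ∩ Δ)
    have z2 := hh0 (t ∩ Δ)
    have z3 := hv0 ((cylinder T Δl ℓ ∩ T^[ℓ.length] ⁻¹' s) ∩ Δ)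
    have z4 := hv0 (t ∩ Δ)
    have z5 := hv0 ((cylinder T Δl ℓ ∩ T^[ℓ.length] ⁻¹' t) ∩ Δ)
    have z6 := hv0 (s ∩ Δ)
    have z7 := hh0 ((cylinder T Δl ℓ ∩ T^[ℓ.length] ⁻¹' t) ∩ Δ)
    have z8 := hh0 (s ∩ Δ)
    rw [hD]
    generalize h ((cylinder T Δl ℓ ∩ T^[ℓ.length] ⁻¹' s) ∩ Δ) = hEs at *
    generalize h ((cylinder T Δl ℓ ∩ T^[ℓ.length] ⁻¹' t) ∩ Δ) = hEt at *
    generalize v ((cylinder T Δl ℓ ∩ T^[ℓ.length] ⁻¹' s) ∩ Δ) = vEs at *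
    generalize v ((cylinder T Δl ℓ ∩ T^[ℓ.length] ⁻¹' t) ∩ Δ) = vEt at *
    generalize h (s ∩ Δ) = hs' at *
    generalize h (t ∩ Δ) = ht' at *
    generalize v (s ∩ Δ) = vs at *
    generalize v (t ∩ Δ) = vt at *
    have hcp : 0 < c ^ (n + 1) := by positivity
    generalize c ^ (n + 1) = g at *
    have m1 : (g * k * vEs) * (δ * vt) ≤ (δ * vs) * (k * vEt) :=
      mul_le_mul p1 p2 (by positivity) (by positivity)
    have m2 : g * (vEs * vt) ≤ vs * vEt := by
      have : (k * δ) * (g * (vEs * vt)) ≤ (k * δ) * (vs * vEt) := by linarith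
      exact le_of_mul_le_mul_left this (by positivity)
    have m3 : (c0 * hEs) * (c0 * ht') ≤ (M * vEs) * (M * vt) :=
      mul_le_mul q1 q2 (by positivity) (by positivity)
    have m4 : vs * vEt ≤ (c0 * hs') * (c0 * hEt) := mul_le_mul q4 q3 (by positivity) (by positivity)
    have m5 : g * (hEs * ht') ≤ M ^ 2 * (hEt * hs') := by
      have : c0 ^ 2 * (g * (hEs * ht')) ≤ c0 ^ 2 * (M ^ 2 * (hEt * hs')) := by
        calc c0 ^ 2 * (g * (hEs * ht')) = g * ((c0 * hEs) * (c0 * ht')) := by ring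
          _ ≤ g * ((M * vEs) * (M * vt)) := by gcongr
          _ = M ^ 2 * (g * (vEs * vt)) := by ring
          _ ≤ M ^ 2 * ((c0 * hs') * (c0 * hEt)) :=
            mul_le_mul_of_nonneg_left (m2.trans m4) (by positivity)
          _ = _ := by ring
      exact le_of_mul_le_mul_left this (by positivity)
    calc hEs * ht' = g⁻¹ * (g * (hEs * ht')) := by field_simp
      _ ≤ g⁻¹ * (M ^ 2 * (hEt * hs')) := by gcongr
      _ = _ := by ring
  -- normalization
  have hlebA : ∀ s, MeasurableSet s → (leb s).toReal = h (s ∩ Δ) := fun s hs => by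
    rw [hleb', Measure.restrict_apply hs]
  have hlebuniv : leb Set.univ ≠ ⊤ := by
    rw [hleb', Measure.restrict_apply_univ]
    exact hHfin Δ subset_rfl hΔmeas
  have hleb0 : leb Set.univ ≠ 0 := fun h0 => (hΔlpos 0).ne' (measure_mono_null (Set.subset_univ _) h0)
  have : IsFiniteMeasure leb := ⟨hlebuniv.lt_top⟩
  have : NeZero leb := ⟨fun h0 => hleb0 (by simp [h0])⟩
  have hhΔ : 0 < h Δ := by
    have := ENNReal.toReal_pos hleb0 hlebuniv
    rwa [hlebA _ .univ, Set.univ_inter] at this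
  set lam : Measure (Fin (n + 1) → ℝ) := (leb Set.univ)⁻¹ • leb with hlam
  have hprob : IsProbabilityMeasure lam := by
    rw [hlam]; infer_instance
  have hlamr : ∀ s, MeasurableSet s → lam.real s = (h Δ)⁻¹ * h (s ∩ Δ) := fun s hs => by
    rw [measureReal_def, hlam, Measure.smul_apply, smul_eq_mul, ENNReal.toReal_mul, ENNReal.toReal_inv,
      hlebA s hs, hlebA _ .univ, Set.univ_inter]
  have hcm := aux_cyl_meas hTmeas hΔlmeas
  have hcu : ∀ ℓ : List ℤ, cylinder T Δl ℓ ∩ T^[ℓ.length] ⁻¹' Set.univ = cylinder T Δl ℓ := fun ℓ => by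
    simp
  obtain ⟨μ, h1, h2, h3, h4⟩ := aux_abstract lam T hTmeas Δl hΔlmeas hΔldisj
    (by
      have : leb (⋃ l, Δl l)ᶜ = 0 := by
        have hm : MeasurableSet (⋃ l, Δl l) := MeasurableSet.iUnion hΔlmeas
        rw [hleb', Measure.restrict_apply (hΔmeas.diff hm)] at hΔlcover
        rw [hleb', Measure.restrict_apply hm.compl]
        refine measure_mono_null ?_ hΔlcover
        rintro x ⟨hx1, hx2⟩
        exact ⟨⟨hx2, hx1⟩, hx2⟩
      rw [hlam, Measure.smul_apply, this, smul_zero]) D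
    (fun ℓ s hs => by
      have key := hdist ℓ s Set.univ hs .univ
      rw [hcu, Set.univ_inter] at key
      rw [hlamr _ ((hcm ℓ).inter (hTmeas.iterate _ hs)), hlamr _ (hcm ℓ), hlamr _ hs,
        inv_mul_le_iff₀ hhΔ]
      calc _ = (h Δ)⁻¹ * (h ((cylinder T Δl ℓ ∩ T^[ℓ.length] ⁻¹' s) ∩ Δ) * h Δ) := by field_simp
        _ ≤ (h Δ)⁻¹ * (D * (h (cylinder T Δl ℓ ∩ Δ) * h (s ∩ Δ))) := by gcongr
        _ = _ := by field_simp)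
    (fun ℓ s hs => by
      have key := hdist ℓ Set.univ s .univ hs
      rw [hcu, Set.univ_inter] at key
      rw [hlamr _ ((hcm ℓ).inter (hTmeas.iterate _ hs)), hlamr _ (hcm ℓ), hlamr _ hs]
      calc _ = (h Δ)⁻¹ * (h Δ)⁻¹ * (h (cylinder T Δl ℓ ∩ Δ) * h (s ∩ Δ)) := by ring
        _ ≤ (h Δ)⁻¹ * (h Δ)⁻¹ * (D * (h ((cylinder T Δl ℓ ∩ T^[ℓ.length] ⁻¹' s) ∩ Δ) * h Δ)) := by
          gcongr
        _ = _ := by field_simp)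
    (fun ℓ => by
      rw [hlamr _ (hcm ℓ)]
      refine mul_pos (inv_pos.2 hhΔ) ?_
      obtain ⟨k, δ, hk, hδ, hkd⟩ := hword ℓ
      have p2 := (hkd Set.univ .univ).2
      rw [hcu, Set.univ_inter] at p2
      have q2 := hhv Δ subset_rfl hΔmeas
      have q3 := hvh (cylinder T Δl ℓ ∩ Δ) Set.inter_subset_right ((hcm ℓ).inter hΔmeas)
      have w1 : 0 < M * v Δ := lt_of_lt_of_le (mul_pos hc0pos hhΔ) q2
      have w2 : 0 < v Δ := pos_of_mul_pos_right w1 hM0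
      have w3 : 0 < k * v (cylinder T Δl ℓ ∩ Δ) := lt_of_lt_of_le (mul_pos hδ w2) p2
      have w4 : 0 < v (cylinder T Δl ℓ ∩ Δ) := pos_of_mul_pos_right w3 hk.le
      exact pos_of_mul_pos_right (lt_of_lt_of_le w4 q3) hc0pos.le)
  refine ⟨μ, h1, h2, h3.trans ?_, h4⟩
  exact Measure.smul_absolutelyContinuous
end
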